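/- arXiv:2501.06854 — 2 statements merged into one kernel-verified Lean document; each statement's English description precedes it below -/
import Mathlib

section
/- The following are equivalent: (i) there exists a universal constant c > 0 such that for every n ≥ 1, every convex body K ⊂ ℝⁿ of volume 1 admits an affine hyperplane H with vol_{n−1}(K ∩ H) ≥ c; (ii) sup_{n ≥ 1} Lₙ < +∞. -/
open MeasureTheory

noncomputable section

/-- A convex body in `ℝⁿ`: a compact convex set with nonempty interior. -/
def IsConvexBody {n : ℕ} (K : Set (EuclideanSpace ℝ (Fin n))) : Prop :=
  IsCompact K ∧ Convex ℝ K ∧ (interior K).Nonempty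

/-- A convex body `K ⊂ ℝⁿ` is in convex isotropic position with constant `L = L_K > 0`
if `Vol(K) = 1`, `∫_K x dx = 0` and `∫_K x xᵀ dx = L_K² Iₙ`. -/
def IsConvexIsotropic {n : ℕ} (K : Set (EuclideanSpace ℝ (Fin n))) (L : ℝ) : Prop :=
  IsConvexBody K ∧ volume K = 1 ∧ 0 < L ∧
  (∀ i, ∫ x in K, x i = 0) ∧
  (∀ i j, ∫ x in K, x i * x j = if i = j then L ^ 2 else 0)

section

open scoped ENNReal Pointwise

theorem volume_add_le_of_add_subset_of_isCompact {A B C : Set ℝ} (hA : IsCompact A)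
    (hB : IsCompact B) (hA₀ : A.Nonempty) (hB₀ : B.Nonempty)
    (h : ∀ x ∈ A, ∀ y ∈ B, x + y ∈ C) : volume A + volume B ≤ volume C := by
  obtain ⟨p, hp, hp'⟩ := hA.exists_isGreatest hA₀
  obtain ⟨q, hq, hq'⟩ := hB.exists_isLeast hB₀
  have h1 : volume ((fun x => x + q) '' A) = volume A := by
    simp [Set.image_add_right]
  have h2 : volume ((fun x => p + x) '' B) = volume B := by
    simp [Set.image_add_left]
  rw [← h1, ← h2, ← measure_union₀ ((hB.image (by fun_prop)).measurableSet.nullMeasurableSet)]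
  · apply measure_mono
    rintro _ (⟨x, hx, rfl⟩ | ⟨x, hx, rfl⟩)
    exacts [h _ hx _ hq, h _ hp _ hx]
  · refine measure_mono_null (t := {p + q}) ?_ (by simp)
    rintro _ ⟨⟨x, hx, rfl⟩, y, hy, hxy⟩
    have := hp' hx
    have := hq' hy
    simp only [Set.mem_singleton_iff] at *
    linarith

theorem volume_add_le_of_add_subset {A B C : Set ℝ} (hA : MeasurableSet A)
    (hB : MeasurableSet B) (hA₀ : A.Nonempty) (hB₀ : B.Nonempty)
    (h : ∀ x ∈ A, ∀ y ∈ B, x + y ∈ C) : volume A + volume B ≤ volume C := by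
  obtain ⟨x₀, hx₀⟩ := hA₀
  obtain ⟨y₀, hy₀⟩ := hB₀
  rw [hA.measure_eq_iSup_isCompact, hB.measure_eq_iSup_isCompact]
  simp_rw [iSup_and']
  refine ENNReal.biSup_add_biSup_le' (p := fun K => K ⊆ A ∧ IsCompact K)
    (q := fun L => L ⊆ B ∧ IsCompact L) ⟨∅, by simp⟩ ⟨∅, by simp⟩ ?_
  rintro K ⟨hKA, hK⟩ L ⟨hLB, hL⟩
  calc volume K + volume L ≤ volume (insert x₀ K) + volume (insert y₀ L) :=
        add_le_add (measure_mono (Set.subset_insert _ _)) (measure_mono (Set.subset_insert _ _))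
    _ ≤ volume C := volume_add_le_of_add_subset_of_isCompact (hK.insert _) (hL.insert _)
        (Set.insert_nonempty _ _) (Set.insert_nonempty _ _) fun x hx y hy =>
          h x (Set.insert_subset hx₀ hKA hx) y (Set.insert_subset hy₀ hLB hy)

theorem volume_convexComb_le {A B C : Set ℝ} {a b : ℝ} (ha : 0 < a) (hb : 0 < b)
    (hA : MeasurableSet A) (hB : MeasurableSet B) (hA₀ : A.Nonempty) (hB₀ : B.Nonempty)
    (h : ∀ x ∈ A, ∀ y ∈ B, a * x + b * y ∈ C) :
    ENNReal.ofReal a * volume A + ENNReal.ofReal b * volume B ≤ volume C := by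
  have key := volume_add_le_of_add_subset (A := a • A) (B := b • B) (C := C)
    (hA.const_smul₀ a) (hB.const_smul₀ b) (hA₀.smul_set) (hB₀.smul_set) (by
      rintro _ ⟨x, hx, rfl⟩ _ ⟨y, hy, rfl⟩
      exact h x hx y hy)
  simpa [Measure.addHaar_smul, abs_of_pos ha, abs_of_pos hb] using key

/-- The one-dimensional Prékopa–Leindler inequality for functions with supremum one. -/
theorem lintegral_convexComb_le {a b : ℝ} (ha : 0 < a) (hb : 0 < b)
    {f g h : ℝ → ℝ} (hf : Measurable f) (hg : Measurable g) (hh : Measurable h)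
    (hf₀ : ∀ x, 0 ≤ f x) (hg₀ : ∀ x, 0 ≤ g x) (hh₀ : ∀ x, 0 ≤ h x)
    (hf₁ : ∀ x, f x ≤ 1) (hg₁ : ∀ x, g x ≤ 1)
    (hf₂ : ∀ t < 1, ∃ x, t < f x) (hg₂ : ∀ t < 1, ∃ x, t < g x) (hab : a + b = 1)
    (hfgh : ∀ x y, f x ^ a * g y ^ b ≤ h (a * x + b * y)) :
    ENNReal.ofReal a * (∫⁻ x, ENNReal.ofReal (f x)) +
      ENNReal.ofReal b * (∫⁻ x, ENNReal.ofReal (g x))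
      ≤ ∫⁻ x, ENNReal.ofReal (h x) := by
  rw [lintegral_eq_lintegral_meas_lt _ (.of_forall hf₀) hf.aemeasurable,
    lintegral_eq_lintegral_meas_lt _ (.of_forall hg₀) hg.aemeasurable,
    lintegral_eq_lintegral_meas_lt _ (.of_forall hh₀) hh.aemeasurable,
    ← lintegral_const_mul' _ _ ENNReal.ofReal_ne_top,
    ← lintegral_const_mul' _ _ ENNReal.ofReal_ne_top, ← lintegral_add_left]
  · refine setLIntegral_mono' measurableSet_Ioi fun t ht => ?_
    rcases lt_or_ge t 1 with h1 | h1
    · refine volume_convexComb_le ha hb (measurableSet_lt measurable_const hf)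
        (measurableSet_lt measurable_const hg) (hf₂ t h1) (hg₂ t h1) fun x hx y hy => ?_
      refine lt_of_lt_of_le ?_ (hfgh x y)
      have ht : 0 < t := ht
      calc t = t ^ a * t ^ b := by rw [← Real.rpow_add ht, hab, Real.rpow_one]
        _ < f x ^ a * g y ^ b := by
          have h1 := Real.rpow_lt_rpow ht.le hx ha
          have h2 := Real.rpow_lt_rpow ht.le hy hb
          have h3 := Real.rpow_pos_of_pos ht a
          have h4 := Real.rpow_pos_of_pos ht b
          exact mul_lt_mul'' h1 h2 h3.le h4.le
    · have e1 : {x | t < f x} = ∅ := by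
        ext x; simpa using (hf₁ x).trans h1
      have e2 : {x | t < g x} = ∅ := by
        ext x; simpa using (hg₁ x).trans h1
      simp [e1, e2]
  · refine Measurable.const_mul ?_ _
    exact Antitone.measurable fun s t hst => measure_mono fun x hx => lt_of_le_of_lt hst hx

theorem ENNReal.rpow_mul_rpow_le_add {a b : ℝ} (ha : 0 < a) (hb : 0 < b) (hab : a + b = 1)
    (x y : ℝ≥0∞) : x ^ a * y ^ b ≤ ENNReal.ofReal a * x + ENNReal.ofReal b * y := by
  have hpq : (a⁻¹).HolderConjugate b⁻¹ := by
    rw [Real.holderConjugate_iff]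
    exact ⟨(one_lt_inv₀ ha).2 (by linarith), by simpa using hab⟩
  have := ENNReal.young_inequality (x ^ a) (y ^ b) hpq
  rw [← ENNReal.rpow_mul, ← ENNReal.rpow_mul, mul_inv_cancel₀ ha.ne', mul_inv_cancel₀ hb.ne',
    ENNReal.rpow_one, ENNReal.rpow_one, ENNReal.ofReal_inv_of_pos ha, ENNReal.ofReal_inv_of_pos hb,
    div_eq_mul_inv, div_eq_mul_inv, inv_inv, inv_inv] at this
  rwa [mul_comm (ENNReal.ofReal a), mul_comm (ENNReal.ofReal b)]

/-- The one-dimensional Prékopa–Leindler inequality for bounded functions. -/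
theorem prekopa_leindler {a b : ℝ} (ha : 0 < a) (hb : 0 < b) (hab : a + b = 1)
    {f g h : ℝ → ℝ} (hf : Measurable f) (hg : Measurable g) (hh : Measurable h)
    (hf₀ : ∀ x, 0 ≤ f x) (hg₀ : ∀ x, 0 ≤ g x) (hh₀ : ∀ x, 0 ≤ h x)
    (hf₁ : BddAbove (Set.range f)) (hg₁ : BddAbove (Set.range g))
    (hfgh : ∀ x y, f x ^ a * g y ^ b ≤ h (a * x + b * y)) :
    (∫⁻ x, ENNReal.ofReal (f x)) ^ a * (∫⁻ x, ENNReal.ofReal (g x)) ^ b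
      ≤ ∫⁻ x, ENNReal.ofReal (h x) := by
  by_cases hfz : ∀ x, f x = 0
  · simp [hfz, ENNReal.zero_rpow_of_pos ha]
  by_cases hgz : ∀ x, g x = 0
  · simp [hgz, ENNReal.zero_rpow_of_pos hb]
  push Not at hfz hgz
  obtain ⟨x₀, hx₀⟩ := hfz
  obtain ⟨y₀, hy₀⟩ := hgz
  set M := ⨆ x, f x with hM
  set N := ⨆ x, g x with hN
  have hMpos : 0 < M := ((hf₀ x₀).lt_of_ne' hx₀).trans_le (le_ciSup hf₁ x₀)
  have hNpos : 0 < N := ((hg₀ y₀).lt_of_ne' hy₀).trans_le (le_ciSup hg₁ y₀)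
  set P := M ^ a * N ^ b with hP
  have hPpos : 0 < P := mul_pos (Real.rpow_pos_of_pos hMpos _) (Real.rpow_pos_of_pos hNpos _)
  have key := (ENNReal.rpow_mul_rpow_le_add ha hb hab _ _).trans <|
    lintegral_convexComb_le ha hb (hf.div_const M) (hg.div_const N) (hh.div_const P)
    (fun x => div_nonneg (hf₀ x) hMpos.le) (fun x => div_nonneg (hg₀ x) hNpos.le)
    (fun x => div_nonneg (hh₀ x) hPpos.le)
    (fun x => (div_le_one hMpos).2 (le_ciSup hf₁ x))
    (fun x => (div_le_one hNpos).2 (le_ciSup hg₁ x))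
    (fun t ht => by
      obtain ⟨x, hx⟩ := exists_lt_of_lt_ciSup (show t * M < ⨆ x, f x by rw [← hM]; nlinarith)
      exact ⟨x, (lt_div_iff₀ hMpos).2 hx⟩)
    (fun t ht => by
      obtain ⟨x, hx⟩ := exists_lt_of_lt_ciSup (show t * N < ⨆ x, g x by rw [← hN]; nlinarith)
      exact ⟨x, (lt_div_iff₀ hNpos).2 hx⟩) hab
    (fun x y => by
      rw [Real.div_rpow (hf₀ x) hMpos.le, Real.div_rpow (hg₀ y) hNpos.le, div_mul_div_comm]
      exact div_le_div_of_nonneg_right (hfgh x y) hPpos.le)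
  have scale : ∀ (u : ℝ → ℝ) {c : ℝ}, 0 < c →
      ∫⁻ x, ENNReal.ofReal (u x) = ENNReal.ofReal c * ∫⁻ x, ENNReal.ofReal (u x / c) := by
    intro u c hc
    rw [← lintegral_const_mul' _ _ ENNReal.ofReal_ne_top]
    refine lintegral_congr fun x => ?_
    rw [← ENNReal.ofReal_mul hc.le, mul_div_cancel₀ _ hc.ne']
  rw [scale f hMpos, scale g hNpos, scale h hPpos, ENNReal.mul_rpow_of_nonneg _ _ ha.le,
    ENNReal.mul_rpow_of_nonneg _ _ hb.le, mul_mul_mul_comm, ENNReal.ofReal_rpow_of_pos hMpos,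
    ENNReal.ofReal_rpow_of_pos hNpos, ← ENNReal.ofReal_mul (Real.rpow_nonneg hMpos.le _)]
  gcongr

theorem isCompact_preimage_insertNth {n : ℕ} {A : Set (Fin (n + 1) → ℝ)} (hA : IsCompact A)
    (i : Fin (n + 1)) (t : ℝ) :
    IsCompact {y : Fin n → ℝ | i.insertNth (α := fun _ => ℝ) t y ∈ A} := by
  have hc := hA.image (f := fun x => i.removeNth x) (by unfold Fin.removeNth; fun_prop)
  refine hc.of_isClosed_subset
    (hA.isClosed.preimage (by fun_prop)) fun y hy => ⟨_, hy, by simp⟩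

theorem lintegral_slice {n : ℕ} {A : Set (Fin (n + 1) → ℝ)} (hA : MeasurableSet A)
    (i : Fin (n + 1)) {F : ℝ → ℝ≥0∞} (hF : Measurable F) :
    ∫⁻ x in A, F (x i) =
      ∫⁻ t, F t * volume {y : Fin n → ℝ | i.insertNth (α := fun _ => ℝ) t y ∈ A} := by
  have hmp := (volume_preserving_piFinSuccAbove (fun _ : Fin (n + 1) => ℝ) i).symm
  rw [← hmp.setLIntegral_comp_preimage_emb (MeasurableEquiv.measurableEmbedding _),
    ← lintegral_indicator (hmp.measurable hA), Measure.volume_eq_prod, lintegral_prod]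
  · refine lintegral_congr fun t => ?_
    have hm : MeasurableSet {y : Fin n → ℝ | i.insertNth (α := fun _ => ℝ) t y ∈ A} :=
      measurable_prodMk_left (hmp.measurable hA)
    rw [← setLIntegral_const, ← lintegral_indicator hm]
    refine lintegral_congr fun y => ?_
    have hy : (MeasurableEquiv.piFinSuccAbove (fun _ : Fin (n + 1) => ℝ) i).symm (t, y) =
        i.insertNth (α := fun _ => ℝ) t y := rfl
    by_cases h : i.insertNth (α := fun _ => ℝ) t y ∈ A
    · rw [Set.indicator_of_mem (show (t, y) ∈ _ from h), Set.indicator_of_mem (show y ∈ _ from h),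
        hy, Fin.insertNth_apply_same]
    · rw [Set.indicator_of_notMem (show (t, y) ∉ _ from h),
        Set.indicator_of_notMem (show y ∉ _ from h)]
  · refine (Measurable.indicator ?_ (hmp.measurable hA)).aemeasurable
    exact hF.comp ((measurable_pi_apply i).comp hmp.measurable)

theorem measurable_volume_slice {n : ℕ} {A : Set (Fin (n + 1) → ℝ)} (hA : MeasurableSet A)
    (i : Fin (n + 1)) :
    Measurable fun t => volume {y : Fin n → ℝ | i.insertNth (α := fun _ => ℝ) t y ∈ A} :=
  measurable_measure_prodMk_left
    ((MeasurableEquiv.piFinSuccAbove (fun _ : Fin (n + 1) => ℝ) i).symm.measurable hA)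

theorem bddAbove_volume_slice {n : ℕ} {A : Set (Fin (n + 1) → ℝ)} (hA : IsCompact A)
    (i : Fin (n + 1)) :
    ∃ M : ℝ≥0∞, M ≠ ∞ ∧
      ∀ t, volume {y : Fin n → ℝ | i.insertNth (α := fun _ => ℝ) t y ∈ A} ≤ M := by
  have hc : IsCompact ((fun x : Fin (n + 1) → ℝ => i.removeNth x) '' A) :=
    hA.image (by unfold Fin.removeNth; fun_prop)
  exact ⟨_, hc.measure_lt_top.ne, fun t => measure_mono fun y hy => ⟨_, hy, by simp⟩⟩

theorem volume_eq_lintegral_slice {n : ℕ} {A : Set (Fin (n + 1) → ℝ)} (hA : MeasurableSet A)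
    (i : Fin (n + 1)) :
    volume A = ∫⁻ t, volume {y : Fin n → ℝ | i.insertNth (α := fun _ => ℝ) t y ∈ A} := by
  simpa using lintegral_slice hA i (F := fun _ => 1) measurable_const

theorem insertNth_convexComb {n : ℕ} (i : Fin (n + 1)) (a b t u : ℝ) (x y : Fin n → ℝ) :
    i.insertNth (α := fun _ => ℝ) (a * t + b * u) (a • x + b • y) =
      a • i.insertNth (α := fun _ => ℝ) t x + b • i.insertNth (α := fun _ => ℝ) u y := by
  ext j
  cases j using i.succAboveCases <;> simp

/-- The multiplicative Brunn–Minkowski inequality for compact sets. -/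
theorem brunn_minkowski {a b : ℝ} (ha : 0 < a) (hb : 0 < b) (hab : a + b = 1) {n : ℕ}
    {A B C : Set (Fin n → ℝ)} (hA : IsCompact A) (hB : IsCompact B) (hC : IsCompact C)
    (h : ∀ x ∈ A, ∀ y ∈ B, a • x + b • y ∈ C) :
    volume A ^ a * volume B ^ b ≤ volume C := by
  induction n with
  | zero =>
    rcases A.eq_empty_or_nonempty with rfl | ⟨x, hx⟩
    · simp [ENNReal.zero_rpow_of_pos ha]
    rcases B.eq_empty_or_nonempty with rfl | ⟨y, hy⟩
    · simp [ENNReal.zero_rpow_of_pos hb]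
    rw [Subsingleton.eq_univ_of_nonempty ⟨x, hx⟩, Subsingleton.eq_univ_of_nonempty ⟨y, hy⟩,
      Subsingleton.eq_univ_of_nonempty ⟨_, h x hx y hy⟩]
    simp [Measure.volume_pi_eq_dirac 0]
  | succ n ih =>
    let s : Set (Fin (n + 1) → ℝ) → ℝ → ℝ≥0∞ := fun S t =>
      volume {y : Fin n → ℝ | (0 : Fin (n + 1)).insertNth (α := fun _ => ℝ) t y ∈ S}
    have hs : ∀ {S}, IsCompact S → ∀ t, s S t ≠ ∞ := fun hS t =>
      (isCompact_preimage_insertNth hS 0 t).measure_lt_top.ne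
    have hv : ∀ {S}, IsCompact S → volume S = ∫⁻ t, ENNReal.ofReal (s S t).toReal := by
      intro S hS
      rw [volume_eq_lintegral_slice hS.measurableSet 0]
      exact lintegral_congr fun t => (ENNReal.ofReal_toReal (hs hS t)).symm
    have hm : ∀ {S}, IsCompact S → Measurable fun t => (s S t).toReal := fun hS =>
      (measurable_volume_slice hS.measurableSet 0).ennreal_toReal
    have hbdd : ∀ {S}, IsCompact S → BddAbove (Set.range fun t => (s S t).toReal) := by
      intro S hS
      obtain ⟨M, hM, hSM⟩ := bddAbove_volume_slice hS 0
      exact ⟨M.toReal, by rintro _ ⟨t, rfl⟩; exact ENNReal.toReal_mono hM (hSM t)⟩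
    rw [hv hA, hv hB, hv hC]
    refine prekopa_leindler ha hb hab (hm hA) (hm hB) (hm hC) (fun _ => ENNReal.toReal_nonneg)
      (fun _ => ENNReal.toReal_nonneg) (fun _ => ENNReal.toReal_nonneg) (hbdd hA) (hbdd hB)
      fun t u => ?_
    rw [ENNReal.toReal_rpow, ENNReal.toReal_rpow, ← ENNReal.toReal_mul]
    refine ENNReal.toReal_mono (hs hC _) (ih (isCompact_preimage_insertNth hA 0 t)
      (isCompact_preimage_insertNth hB 0 u) (isCompact_preimage_insertNth hC 0 _)
      fun x hx y hy => ?_)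
    change Fin.insertNth _ _ _ ∈ C
    rw [insertNth_convexComb]
    exact h _ hx _ hy

/-- A log-concave probability density `u` is at most `u 0 / e` at distance `3 / u 0`. -/
theorem logConcave_le_div_exp_one {u : ℝ → ℝ}
    (hlc : ∀ a b : ℝ, 0 < a → 0 < b → a + b = 1 → ∀ s t, u s ^ a * u t ^ b ≤ u (a * s + b * t))
    (hint : ∫⁻ s, ENNReal.ofReal (u s) = 1) (h0 : 0 < u 0) {s : ℝ} (hs : |s| = 3 / u 0) :
    u s ≤ u 0 * Real.exp (-1) := by
  by_contra! hlt
  set q := u 0 * Real.exp (-1) with hq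
  have hqpos : 0 < q := by positivity
  have hq0 : q ≤ u 0 := mul_le_of_le_one_right h0.le (by simp)
  have hsub : ∀ x ∈ Set.Ioo 0 s ∪ Set.Ioo s 0, q ≤ u x := by
    intro x hx
    have hs0 : s ≠ 0 := by rintro rfl; simp at hx
    have hb : 0 < x / s := by
      rcases hx with hx | hx
      · exact div_pos hx.1 (hx.1.trans hx.2)
      · exact div_pos_of_neg_of_neg hx.2 (hx.1.trans hx.2)
    have hb1 : x / s < 1 := by
      rcases hx with hx | hx
      · exact (div_lt_one (hx.1.trans hx.2)).2 hx.2
      · exact (div_lt_one_of_neg (hx.1.trans hx.2)).2 hx.1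
    have := hlc (1 - x / s) (x / s) (by linarith) hb (by ring) 0 s
    rw [mul_zero, zero_add, div_mul_cancel₀ _ hs0] at this
    refine le_trans ?_ this
    calc q = q ^ (1 - x / s) * q ^ (x / s) := by
          rw [← Real.rpow_add hqpos, sub_add_cancel, Real.rpow_one]
      _ ≤ _ := by gcongr
  have hvol : ENNReal.ofReal |s| ≤ volume (Set.Ioo 0 s ∪ Set.Ioo s 0) := by
    rcases le_total 0 s with h | h
    · rw [abs_of_nonneg h]
      simpa using measure_mono (μ := volume)
        (Set.subset_union_left (s := Set.Ioo 0 s) (t := Set.Ioo s 0))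
    · rw [abs_of_nonpos h]
      simpa using measure_mono (μ := volume)
        (Set.subset_union_right (s := Set.Ioo 0 s) (t := Set.Ioo s 0))
  have h1 : ENNReal.ofReal (q * |s|) ≤ 1 := by
    rw [← hint, ENNReal.ofReal_mul hqpos.le]
    calc _ ≤ ENNReal.ofReal q * volume (Set.Ioo 0 s ∪ Set.Ioo s 0) := by gcongr
      _ = ∫⁻ _ in Set.Ioo 0 s ∪ Set.Ioo s 0, ENNReal.ofReal q := by simp
      _ ≤ ∫⁻ x in Set.Ioo 0 s ∪ Set.Ioo s 0, ENNReal.ofReal (u x) :=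
        setLIntegral_mono' (measurableSet_Ioo.union measurableSet_Ioo) fun x hx =>
          ENNReal.ofReal_le_ofReal (hsub x hx)
      _ ≤ _ := setLIntegral_le_lintegral _ _
  rw [ENNReal.ofReal_le_one, hs, hq, Real.exp_neg] at h1
  have h2 := Real.exp_one_lt_three
  have h3 : u 0 * (Real.exp 1)⁻¹ * (3 / u 0) = 3 / Real.exp 1 := by field_simp
  rw [h3, div_le_one (Real.exp_pos 1)] at h1
  linarith

theorem logConcave_le_exp {u : ℝ → ℝ} (hu : ∀ s, 0 ≤ u s)
    (hlc : ∀ a b : ℝ, 0 < a → 0 < b → a + b = 1 → ∀ s t, u s ^ a * u t ^ b ≤ u (a * s + b * t))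
    (hint : ∫⁻ s, ENNReal.ofReal (u s) = 1) (h0 : 0 < u 0) {s : ℝ} (hs : 3 / u 0 ≤ |s|) :
    u s ≤ u 0 * Real.exp (-(|s| / (3 / u 0))) := by
  set r := 3 / u 0 with hr
  have hr0 : 0 < r := by positivity
  rcases hs.eq_or_lt with h | h
  · rw [← h, div_self hr0.ne']
    exact logConcave_le_div_exp_one hlc hint h0 h.symm
  have hs0 : 0 < |s| := hr0.trans h
  set b := r / |s| with hb
  have hb0 : 0 < b := by positivity
  have hb1 : b < 1 := (div_lt_one hs0).2 h
  have h1 := hlc (1 - b) b (by linarith) hb0 (by ring) 0 s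
  have h2 := logConcave_le_div_exp_one hlc hint h0 (s := (1 - b) * 0 + b * s) (by
    rw [mul_zero, zero_add, abs_mul, abs_of_pos hb0, hb, div_mul_cancel₀ _ hs0.ne'])
  have h3 : (u s / u 0) ^ b ≤ Real.exp (-1) := by
    rw [Real.div_rpow (hu s) h0.le, div_le_iff₀ (Real.rpow_pos_of_pos h0 _)]
    refine le_of_mul_le_mul_left ((h1.trans h2).trans_eq ?_) (Real.rpow_pos_of_pos h0 (1 - b))
    rw [mul_left_comm, ← Real.rpow_add h0, sub_add_cancel, Real.rpow_one, mul_comm]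
  have h4 := Real.rpow_le_rpow (Real.rpow_nonneg (div_nonneg (hu s) h0.le) _) h3
    (inv_nonneg.2 hb0.le)
  rw [← Real.rpow_mul (div_nonneg (hu s) h0.le), mul_inv_cancel₀ hb0.ne', Real.rpow_one,
    ← Real.exp_mul, div_le_iff₀ h0, mul_comm, hb, inv_div, neg_one_mul] at h4
  exact h4

theorem logConcave_sq_mul_le {u : ℝ → ℝ} (hu : ∀ s, 0 ≤ u s)
    (hlc : ∀ a b : ℝ, 0 < a → 0 < b → a + b = 1 → ∀ s t, u s ^ a * u t ^ b ≤ u (a * s + b * t))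
    (hint : ∫⁻ s, ENNReal.ofReal (u s) = 1) (h0 : 0 < u 0) (s : ℝ) :
    s ^ 2 * u s ≤ (3 / u 0) ^ 2 * u s + 8 * (3 / u 0) ^ 2 * u (2⁻¹ * s) := by
  rcases le_total |s| (3 / u 0) with hs | hs
  · have h1 : s ^ 2 ≤ (3 / u 0) ^ 2 :=
      sq_le_sq' (by linarith [neg_abs_le s]) (by linarith [le_abs_self s])
    have h2 := mul_le_mul_of_nonneg_right h1 (hu s)
    have h3 : 0 ≤ 8 * (3 / u 0) ^ 2 * u (2⁻¹ * s) := mul_nonneg (by positivity) (hu _)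
    linarith
  have h1 := logConcave_le_exp hu hlc hint h0 hs
  set r := 3 / u 0 with hr
  have hr0 : 0 < r := by positivity
  have h2 : u 0 * u s ≤ u (2⁻¹ * s) ^ 2 := by
    have h := hlc 2⁻¹ 2⁻¹ (by norm_num) (by norm_num) (by norm_num) 0 s
    rw [mul_zero, zero_add, ← Real.mul_rpow h0.le (hu s)] at h
    have h' := pow_le_pow_left₀ (Real.rpow_nonneg (mul_nonneg h0.le (hu s)) _) h 2
    rwa [← Real.rpow_natCast, ← Real.rpow_mul (mul_nonneg h0.le (hu s)), Nat.cast_ofNat,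
      inv_mul_cancel₀ (by norm_num), Real.rpow_one] at h'
  set y := |s| / (2 * r) with hy
  have hy0 : 0 ≤ y := by positivity
  have hexp : Real.exp (-(|s| / r)) = Real.exp (-y) ^ 2 := by
    rw [← Real.exp_nat_mul, hy]; congr 1; push_cast; field_simp
  have h3 : u s ≤ u (2⁻¹ * s) * Real.exp (-y) := by
    refine le_of_sq_le_sq ?_ ?_
    · calc u s ^ 2 ≤ u s * (u 0 * Real.exp (-(|s| / r))) := by
            rw [sq]; exact mul_le_mul_of_nonneg_left h1 (hu s)
        _ = u 0 * u s * Real.exp (-y) ^ 2 := by rw [hexp]; ring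
        _ ≤ u (2⁻¹ * s) ^ 2 * Real.exp (-y) ^ 2 := by gcongr
        _ = _ := by ring
    · exact mul_nonneg (hu _) (Real.exp_pos _).le
  have h4 : s ^ 2 * Real.exp (-y) ≤ 8 * r ^ 2 := by
    have h5 := Real.quadratic_le_exp_of_nonneg hy0
    have h6 : s ^ 2 = 8 * r ^ 2 * (y ^ 2 / 2) := by
      rw [hy, div_pow |s|, sq_abs]; field_simp; ring
    rw [Real.exp_neg, ← div_eq_mul_inv, div_le_iff₀ (Real.exp_pos y), h6]
    gcongr
    linarith
  calc s ^ 2 * u s ≤ s ^ 2 * (u (2⁻¹ * s) * Real.exp (-y)) := by gcongr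
    _ = s ^ 2 * Real.exp (-y) * u (2⁻¹ * s) := by ring
    _ ≤ 8 * r ^ 2 * u (2⁻¹ * s) := mul_le_mul_of_nonneg_right h4 (hu _)
    _ ≤ _ := le_add_of_nonneg_left (mul_nonneg (by positivity) (hu s))

/-- A log-concave probability density has second moment about `0` at most `153 / (u 0) ^ 2`. -/
theorem logConcave_lintegral_sq_le {u : ℝ → ℝ} (hum : Measurable u) (hu : ∀ s, 0 ≤ u s)
    (hlc : ∀ a b : ℝ, 0 < a → 0 < b → a + b = 1 → ∀ s t, u s ^ a * u t ^ b ≤ u (a * s + b * t))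
    (hint : ∫⁻ s, ENNReal.ofReal (u s) = 1) (h0 : 0 < u 0) :
    ∫⁻ s, ENNReal.ofReal (s ^ 2 * u s) ≤ ENNReal.ofReal (153 / u 0 ^ 2) := by
  have hhalf : ∫⁻ s, ENNReal.ofReal (u (2⁻¹ * s)) = 2 := by
    have h := Real.smul_map_volume_mul_left (a := 2⁻¹) (by norm_num)
    rw [← h, lintegral_smul_measure, lintegral_map (by fun_prop) (by fun_prop),
      abs_of_pos (by norm_num),
      smul_eq_mul, ENNReal.ofReal_inv_of_pos (by norm_num), ENNReal.ofReal_ofNat] at hint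
    rw [← one_mul (∫⁻ s, _), ← ENNReal.mul_inv_cancel (a := 2) (by simp) (by simp), mul_assoc, hint,
      mul_one]
  set r := 3 / u 0 with hr
  calc ∫⁻ s, ENNReal.ofReal (s ^ 2 * u s)
      ≤ ∫⁻ s, (ENNReal.ofReal (r ^ 2) * ENNReal.ofReal (u s) +
          ENNReal.ofReal (8 * r ^ 2) * ENNReal.ofReal (u (2⁻¹ * s))) := by
        refine lintegral_mono fun s => ?_
        rw [← ENNReal.ofReal_mul (by positivity), ← ENNReal.ofReal_mul (by positivity),
          ← ENNReal.ofReal_add (mul_nonneg (by positivity) (hu _))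
            (mul_nonneg (by positivity) (hu _))]
        exact ENNReal.ofReal_le_ofReal (logConcave_sq_mul_le hu hlc hint h0 s)
    _ = ENNReal.ofReal (r ^ 2) * 1 + ENNReal.ofReal (8 * r ^ 2) * 2 := by
        rw [lintegral_add_left (by fun_prop), lintegral_const_mul _ (by fun_prop),
          lintegral_const_mul _ (by fun_prop), hint, hhalf]
    _ = ENNReal.ofReal (153 / u 0 ^ 2) := by
        rw [← ENNReal.ofReal_one, ← ENNReal.ofReal_ofNat (n := 2),
          ← ENNReal.ofReal_mul (by positivity), ← ENNReal.ofReal_mul (by positivity),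
          ← ENNReal.ofReal_add (by positivity) (by positivity), hr]
        congr 1
        field_simp
        norm_num

/-- The isometric embedding of `ℝⁿ` into `ℝⁿ⁺¹` that inserts a zero coordinate at position `i`. -/
def insertZero {n : ℕ} (i : Fin (n + 1)) :
    EuclideanSpace ℝ (Fin n) →ₗᵢ[ℝ] EuclideanSpace ℝ (Fin (n + 1)) where
  toFun y := WithLp.toLp 2 (i.insertNth (α := fun _ => ℝ) 0 y.ofLp)
  map_add' x y := by
    ext j
    cases j using i.succAboveCases <;> simp
  map_smul' c x := by
    ext j
    cases j using i.succAboveCases <;> simp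
  norm_map' x := by
    simp [EuclideanSpace.norm_eq, Fin.sum_univ_succAbove _ i]

theorem insertZero_add_toLp {n : ℕ} (i : Fin (n + 1)) (y : EuclideanSpace ℝ (Fin n)) (t : ℝ)
    (q : Fin n → ℝ) :
    insertZero i y + WithLp.toLp 2 (i.insertNth (α := fun _ => ℝ) t q) =
      WithLp.toLp 2 (i.insertNth (α := fun _ => ℝ) t (y.ofLp + q)) := by
  ext j
  cases j using i.succAboveCases <;> simp [insertZero]

/-- Every affine isometric embedding of `ℝⁿ` into `ℝⁿ⁺¹` is a rotation of a coordinate slice. -/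
theorem exists_rotation_slice {n : ℕ}
    (φ : EuclideanSpace ℝ (Fin n) →ᵃⁱ[ℝ] EuclideanSpace ℝ (Fin (n + 1))) :
    ∃ (R : EuclideanSpace ℝ (Fin (n + 1)) ≃ₗᵢ[ℝ] EuclideanSpace ℝ (Fin (n + 1))) (t : ℝ)
      (q : Fin n → ℝ), ∀ y, φ y =
        R (WithLp.toLp 2 ((0 : Fin (n + 1)).insertNth (α := fun _ => ℝ) t (y.ofLp + q))) := by
  let ι := insertZero (n := n) 0
  let R₀ := (φ.linearIsometry.comp ι.equivRange.symm.toLinearIsometry).extend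
  let R : EuclideanSpace ℝ (Fin (n + 1)) ≃ₗᵢ[ℝ] EuclideanSpace ℝ (Fin (n + 1)) :=
    R₀.toLinearIsometryEquiv rfl
  have hR : ∀ y, R (ι y) = φ.linearIsometry y := by
    intro y
    have h := LinearIsometry.extend_apply
      (φ.linearIsometry.comp ι.equivRange.symm.toLinearIsometry) (ι.equivRange y)
    calc R (ι y) = φ.linearIsometry (ι.equivRange.symm (ι.equivRange y)) := h
      _ = φ.linearIsometry y := by rw [LinearIsometryEquiv.symm_apply_apply]
  refine ⟨R, R.symm (φ 0) 0, Fin.removeNth 0 (R.symm (φ 0)).ofLp, fun y => ?_⟩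
  rw [← insertZero_add_toLp, Fin.insertNth_self_removeNth, map_add]
  change φ y = R (ι y) + R (R.symm (φ 0))
  rw [hR, LinearIsometryEquiv.apply_symm_apply]
  have := φ.map_vadd 0 y
  simpa using this

/-- The affine parametrization `x ↦ R x + p` of `ℝⁿ` by coordinates preserves volume. -/
theorem measurePreserving_rotation_add {n : ℕ}
    (R : EuclideanSpace ℝ (Fin n) ≃ₗᵢ[ℝ] EuclideanSpace ℝ (Fin n)) (p : EuclideanSpace ℝ (Fin n)) :
    MeasurePreserving (fun x : Fin n → ℝ => R (WithLp.toLp 2 x) + p) volume volume :=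
  (measurePreserving_add_right volume p).comp
    (R.measurePreserving.comp (PiLp.volume_preserving_toLp (Fin n)))

theorem measurableEmbedding_rotation_add {n : ℕ}
    (R : EuclideanSpace ℝ (Fin n) ≃ₗᵢ[ℝ] EuclideanSpace ℝ (Fin n)) (p : EuclideanSpace ℝ (Fin n)) :
    MeasurableEmbedding (fun x : Fin n → ℝ => R (WithLp.toLp 2 x) + p) :=
  (measurableEmbedding_addRight p).comp
    (R.toHomeomorph.measurableEmbedding.comp
      (MeasurableEquiv.toLp 2 (Fin n → ℝ)).measurableEmbedding)

theorem isCompact_preimage_rotation_add {n : ℕ} {K : Set (EuclideanSpace ℝ (Fin n))}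
    (hK : IsCompact K) (R : EuclideanSpace ℝ (Fin n) ≃ₗᵢ[ℝ] EuclideanSpace ℝ (Fin n))
    (p : EuclideanSpace ℝ (Fin n)) :
    IsCompact {x : Fin n → ℝ | R (WithLp.toLp 2 x) + p ∈ K} := by
  refine (hK.image (f := fun z => (R.symm (z - p)).ofLp) (by fun_prop)).of_isClosed_subset
    (hK.isClosed.preimage (by fun_prop)) fun x hx => ⟨_, hx, by simp⟩

theorem convex_preimage_rotation_add {n : ℕ} {K : Set (EuclideanSpace ℝ (Fin n))}
    (hK : Convex ℝ K) (R : EuclideanSpace ℝ (Fin n) ≃ₗᵢ[ℝ] EuclideanSpace ℝ (Fin n))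
    (p : EuclideanSpace ℝ (Fin n)) :
    Convex ℝ {x : Fin n → ℝ | R (WithLp.toLp 2 x) + p ∈ K} := by
  intro x hx y hy a b ha hb hab
  have := hK hx hy ha hb hab
  rw [Set.mem_ofPred_eq]
  convert this using 1
  change R (WithLp.toLp 2 (a • x + b • y)) + p = _
  rw [WithLp.toLp_add, WithLp.toLp_smul, WithLp.toLp_smul, map_add, map_smul, map_smul, smul_add,
    smul_add, add_add_add_comm, ← add_smul, hab, one_smul]

/-- A large slice of a convex set of volume one forces a small second moment in the orthogonal
direction. -/
theorem lintegral_sq_sub_le_of_le_volume_slice {n : ℕ} {A : Set (Fin (n + 1) → ℝ)}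
    (hA : IsCompact A) (hconv : Convex ℝ A) (hvol : volume A = 1) (i : Fin (n + 1)) {c t₀ : ℝ}
    (hc : 0 < c)
    (ht₀ : ENNReal.ofReal c ≤
      volume {y : Fin n → ℝ | i.insertNth (α := fun _ => ℝ) t₀ y ∈ A}) :
    ∫⁻ x in A, ENNReal.ofReal ((x i - t₀) ^ 2) ≤ ENNReal.ofReal (153 / c ^ 2) := by
  set f : ℝ → ℝ≥0∞ := fun t =>
    volume {y : Fin n → ℝ | i.insertNth (α := fun _ => ℝ) t y ∈ A} with hf
  have hfin : ∀ t, f t ≠ ∞ := fun t => (isCompact_preimage_insertNth hA i t).measure_lt_top.ne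
  have hfm : Measurable f := measurable_volume_slice hA.measurableSet i
  set u : ℝ → ℝ := fun s => (f (s + t₀)).toReal with hu
  have hum : Measurable u := (hfm.comp (measurable_add_const t₀)).ennreal_toReal
  have hofu : ∀ s, ENNReal.ofReal (u s) = f (s + t₀) := fun s => ENNReal.ofReal_toReal (hfin _)
  have hcu : c ≤ u 0 := by
    rw [hu]
    simpa using (ENNReal.ofReal_le_iff_le_toReal (hfin t₀)).1 ht₀
  have hlc : ∀ a b : ℝ, 0 < a → 0 < b → a + b = 1 → ∀ s t,
      u s ^ a * u t ^ b ≤ u (a * s + b * t) := by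
    intro a b ha hb hab s t
    rw [hu]
    simp only []
    rw [ENNReal.toReal_rpow, ENNReal.toReal_rpow, ← ENNReal.toReal_mul]
    refine ENNReal.toReal_mono (hfin _) (brunn_minkowski ha hb hab
      (isCompact_preimage_insertNth hA i _) (isCompact_preimage_insertNth hA i _)
      (isCompact_preimage_insertNth hA i _) fun x hx y hy => ?_)
    have he : a * s + b * t + t₀ = a * (s + t₀) + b * (t + t₀) := by linear_combination -t₀ * hab
    change Fin.insertNth _ _ _ ∈ A
    rw [he, insertNth_convexComb]
    exact hconv hx hy ha.le hb.le hab
  have hint : ∫⁻ s, ENNReal.ofReal (u s) = 1 := by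
    simp_rw [hofu]
    rw [lintegral_add_right_eq_self f, hf, ← volume_eq_lintegral_slice hA.measurableSet, hvol]
  calc ∫⁻ x in A, ENNReal.ofReal ((x i - t₀) ^ 2)
      = ∫⁻ t, ENNReal.ofReal ((t - t₀) ^ 2) * f t :=
        lintegral_slice hA.measurableSet i (F := fun t => ENNReal.ofReal ((t - t₀) ^ 2))
          (by fun_prop)
    _ = ∫⁻ s, ENNReal.ofReal (s ^ 2 * u s) := by
        rw [← lintegral_add_right_eq_self _ t₀]
        refine lintegral_congr fun s => ?_
        rw [add_sub_cancel_right, ENNReal.ofReal_mul (sq_nonneg s), hofu]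
    _ ≤ ENNReal.ofReal (153 / u 0 ^ 2) :=
        logConcave_lintegral_sq_le hum (fun _ => ENNReal.toReal_nonneg) hlc hint
          (hc.trans_le hcu)
    _ ≤ _ := by gcongr

theorem integrableOn_of_continuous {n : ℕ} {K : Set (EuclideanSpace ℝ (Fin n))}
    (hK : IsCompact K) {f : EuclideanSpace ℝ (Fin n) → ℝ} (hf : Continuous f) :
    IntegrableOn f K :=
  hf.continuousOn.integrableOn_compact hK

theorem integral_inner_of_isotropic {n : ℕ} {K : Set (EuclideanSpace ℝ (Fin n))} {L : ℝ}
    (hK : IsConvexIsotropic K L) (v : EuclideanSpace ℝ (Fin n)) :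
    ∫ x in K, inner ℝ v x = 0 := by
  obtain ⟨⟨hc, -, -⟩, -, -, h1, -⟩ := hK
  simp_rw [PiLp.inner_apply]
  rw [integral_finsetSum _ fun i _ =>
    integrableOn_of_continuous hc (by fun_prop)]
  refine Finset.sum_eq_zero fun i _ => ?_
  simp [integral_mul_const, h1]

theorem integral_inner_sq_of_isotropic {n : ℕ} {K : Set (EuclideanSpace ℝ (Fin n))} {L : ℝ}
    (hK : IsConvexIsotropic K L) (v : EuclideanSpace ℝ (Fin n)) :
    ∫ x in K, (inner ℝ v x) ^ 2 = L ^ 2 * ‖v‖ ^ 2 := by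
  obtain ⟨⟨hc, -, -⟩, -, -, -, h2⟩ := hK
  have he : ∀ x : EuclideanSpace ℝ (Fin n),
      (inner ℝ v x) ^ 2 = ∑ i, ∑ j, (v i * v j) * (x i * x j) := by
    intro x
    rw [PiLp.inner_apply, sq, Finset.sum_mul_sum]
    refine Finset.sum_congr rfl fun i _ => Finset.sum_congr rfl fun j _ => ?_
    simp
    ring
  simp_rw [he]
  rw [integral_finsetSum _ fun i _ => integrableOn_of_continuous hc (by fun_prop)]
  rw [EuclideanSpace.real_norm_sq_eq, Finset.mul_sum]
  refine Finset.sum_congr rfl fun i _ => ?_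
  rw [integral_finsetSum _ fun i _ => integrableOn_of_continuous hc (by fun_prop)]
  simp_rw [integral_const_mul, h2]
  simp
  ring

theorem isotropic_constant_le_of_slice {n : ℕ} {K : Set (EuclideanSpace ℝ (Fin (n + 1)))} {L c : ℝ}
    (hK : IsConvexIsotropic K L) (hc : 0 < c)
    (φ : EuclideanSpace ℝ (Fin n) →ᵃⁱ[ℝ] EuclideanSpace ℝ (Fin (n + 1)))
    (hφ : ENNReal.ofReal c ≤ volume (φ ⁻¹' K)) : L ≤ 13 / c := by
  obtain ⟨R, t, q, hR⟩ := exists_rotation_slice φ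
  have hcomp := hK.1.1
  set A : Set (Fin (n + 1) → ℝ) := {x | R (WithLp.toLp 2 x) + 0 ∈ K} with hA
  have hAc : IsCompact A := isCompact_preimage_rotation_add hcomp R 0
  have hmp := measurePreserving_rotation_add R 0
  have hvA : volume A = 1 := by
    rw [← hK.2.1]; exact hmp.measure_preimage hcomp.measurableSet.nullMeasurableSet
  have hslice : volume (φ ⁻¹' K) =
      volume {y : Fin n → ℝ | (0 : Fin (n + 1)).insertNth (α := fun _ => ℝ) t y ∈ A} := by
    have hcl : MeasurableSet (φ ⁻¹' K) :=
      (hcomp.isClosed.preimage φ.continuous).measurableSet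
    rw [← (PiLp.volume_preserving_toLp (Fin n)).measure_preimage hcl.nullMeasurableSet,
      ← measure_preimage_add_right volume q {y : Fin n → ℝ | _}]
    congr 1
    ext y
    simp [hA, hR]
  rw [hslice] at hφ
  have key := lintegral_sq_sub_le_of_le_volume_slice hAc
    (convex_preimage_rotation_add hK.1.2.1 R 0) hvA 0 hc hφ
  set v : EuclideanSpace ℝ (Fin (n + 1)) := R (EuclideanSpace.single 0 1) with hv
  have hcoord : ∀ x : Fin (n + 1) → ℝ, inner ℝ v (R (WithLp.toLp 2 x) + 0) = x 0 := by
    intro x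
    rw [add_zero, hv, R.inner_map_map, EuclideanSpace.inner_single_left]
    simp
  have hchange : ∫⁻ x in A, ENNReal.ofReal ((x 0 - t) ^ 2) =
      ∫⁻ z in K, ENNReal.ofReal ((inner ℝ v z - t) ^ 2) := by
    rw [← hmp.setLIntegral_comp_preimage_emb (measurableEmbedding_rotation_add R 0)]
    simp_rw [hcoord]
    rfl
  rw [hchange, ← ofReal_integral_eq_lintegral_ofReal
    (integrableOn_of_continuous hcomp (by fun_prop)) (.of_forall fun _ => sq_nonneg _),
    ENNReal.ofReal_le_ofReal_iff (by positivity)] at key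
  have hexp : ∫ z in K, (inner ℝ v z - t) ^ 2 = L ^ 2 + t ^ 2 := by
    have h1 : ∀ z, (inner ℝ v z - t) ^ 2 = (inner ℝ v z) ^ 2 - 2 * t * inner ℝ v z + t ^ 2 := by
      intro z; ring
    have hvn : ‖v‖ = 1 := by simp [hv]
    simp_rw [h1]
    rw [integral_add, integral_sub, integral_const_mul, integral_inner_of_isotropic hK,
      integral_inner_sq_of_isotropic hK, hvn]
    · simp [Measure.real, hK.2.1]
    all_goals exact integrableOn_of_continuous hcomp (by fun_prop)
  rw [hexp] at key
  refine le_of_sq_le_sq ?_ (by positivity)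
  calc L ^ 2 ≤ 153 / c ^ 2 := by linarith [sq_nonneg t]
    _ ≤ (13 / c) ^ 2 := by rw [div_pow]; gcongr; norm_num

/-- A set of volume one whose squared `i`-th coordinate has small mean has a large slice orthogonal
to that coordinate. -/
theorem exists_le_volume_slice {n : ℕ} {A : Set (Fin (n + 1) → ℝ)} (hA : MeasurableSet A)
    (hvol : volume A = 1) (i : Fin (n + 1)) {C : ℝ} (hC : 0 < C)
    (hmom : ∫⁻ x in A, ENNReal.ofReal (x i ^ 2) ≤ ENNReal.ofReal (C ^ 2)) :
    ∃ t, ENNReal.ofReal (1 / (8 * C)) ≤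
      volume {y : Fin n → ℝ | i.insertNth (α := fun _ => ℝ) t y ∈ A} := by
  set f : ℝ → ℝ≥0∞ := fun t =>
    volume {y : Fin n → ℝ | i.insertNth (α := fun _ => ℝ) t y ∈ A} with hf
  by_contra! hlt
  have hfm : Measurable f := measurable_volume_slice hA i
  rw [lintegral_slice hA i (F := fun t => ENNReal.ofReal (t ^ 2)) (by fun_prop)] at hmom
  have hpt : ∀ t, f t ≤ (Set.Icc (-(2 * C)) (2 * C)).indicator
      (fun _ => ENNReal.ofReal (1 / (8 * C))) t +
        ENNReal.ofReal (1 / (4 * C ^ 2)) * (ENNReal.ofReal (t ^ 2) * f t) := by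
    intro t
    by_cases ht : t ∈ Set.Icc (-(2 * C)) (2 * C)
    · rw [Set.indicator_of_mem ht]
      exact (hlt t).le.trans le_self_add
    · rw [Set.indicator_of_notMem ht, zero_add, ← mul_assoc,
        ← ENNReal.ofReal_mul (by positivity)]
      refine le_mul_of_one_le_left zero_le ?_
      rw [ENNReal.one_le_ofReal, one_div_mul_eq_div, one_le_div (by positivity)]
      have h1 : 2 * C < |t| := by
        by_contra! h
        exact ht (abs_le.1 h)
      have h2 := pow_lt_pow_left₀ h1 (by positivity) two_ne_zero
      rw [sq_abs] at h2
      linarith [mul_pow 2 C 2]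
  have htot : (1 : ℝ≥0∞) ≤ ENNReal.ofReal (3 / 4) := by
    calc 1 = ∫⁻ t, f t := by rw [← hvol, volume_eq_lintegral_slice hA i]
      _ ≤ ∫⁻ t, ((Set.Icc (-(2 * C)) (2 * C)).indicator
          (fun _ => ENNReal.ofReal (1 / (8 * C))) t +
            ENNReal.ofReal (1 / (4 * C ^ 2)) * (ENNReal.ofReal (t ^ 2) * f t)) :=
        lintegral_mono hpt
      _ = ENNReal.ofReal (1 / (8 * C)) * ENNReal.ofReal (2 * C - -(2 * C)) +
          ENNReal.ofReal (1 / (4 * C ^ 2)) * ∫⁻ t, ENNReal.ofReal (t ^ 2) * f t := by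
        rw [lintegral_add_left (measurable_const.indicator measurableSet_Icc),
          lintegral_indicator measurableSet_Icc, setLIntegral_const, Real.volume_Icc,
          lintegral_const_mul _ (by fun_prop)]
      _ ≤ ENNReal.ofReal (1 / (8 * C)) * ENNReal.ofReal (2 * C - -(2 * C)) +
          ENNReal.ofReal (1 / (4 * C ^ 2)) * ENNReal.ofReal (C ^ 2) := by gcongr
      _ = ENNReal.ofReal (3 / 4) := by
        rw [← ENNReal.ofReal_mul (by positivity), ← ENNReal.ofReal_mul (by positivity),
          ← ENNReal.ofReal_add (mul_nonneg (by positivity) (by linarith)) (by positivity)]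
        congr 1
        field_simp
        norm_num
  rw [ENNReal.one_le_ofReal] at htot
  norm_num at htot

/-- Principal axes: every compact set of volume one has a rotated, centred coordinate system with
diagonal covariance. -/
theorem exists_rotation_diagonal_covariance {n : ℕ} {K : Set (EuclideanSpace ℝ (Fin n))}
    (hK : IsCompact K) (hvol : volume K = 1) :
    ∃ (R : EuclideanSpace ℝ (Fin n) ≃ₗᵢ[ℝ] EuclideanSpace ℝ (Fin n))
      (p : EuclideanSpace ℝ (Fin n)) (d : Fin n → ℝ),
      (∀ i, ∫ z in K, R.symm (z - p) i = 0) ∧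
      ∀ i j, ∫ z in K, R.symm (z - p) i * R.symm (z - p) j = if i = j then d i else 0 := by
  set p : EuclideanSpace ℝ (Fin n) := WithLp.toLp 2 fun i => ∫ z in K, z i with hp
  let M : Matrix (Fin n) (Fin n) ℝ := .of fun i j => ∫ z in K, (z - p) i * (z - p) j
  have hM : M.IsHermitian := by
    ext i j
    simp [M, mul_comm]
  have hcent : ∀ i, ∫ z in K, (z - p) i = 0 := by
    intro i
    simp_rw [PiLp.sub_apply]
    rw [integral_sub (integrableOn_of_continuous hK (by fun_prop))
      (integrableOn_of_continuous hK (by fun_prop))]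
    simp [Measure.real, hvol, hp]
  refine ⟨hM.eigenvectorBasis.repr.symm, p, hM.eigenvalues, fun i => ?_, fun i j => ?_⟩
  · simp_rw [LinearIsometryEquiv.symm_symm, OrthonormalBasis.repr_apply_apply, PiLp.inner_apply]
    rw [integral_finsetSum _ fun i _ => integrableOn_of_continuous hK (by fun_prop)]
    refine Finset.sum_eq_zero fun k _ => ?_
    have := hcent k
    simp only [RCLike.inner_apply, conj_trivial, integral_mul_const, this, zero_mul]
  · set β := hM.eigenvectorBasis with hβ
    have he : ∀ z, β.repr (z - p) i * β.repr (z - p) j =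
        ∑ k, ∑ l, (β i k * β j l) * ((z - p) k * (z - p) l) := by
      intro z
      rw [OrthonormalBasis.repr_apply_apply, OrthonormalBasis.repr_apply_apply, PiLp.inner_apply,
        PiLp.inner_apply, Finset.sum_mul_sum]
      refine Finset.sum_congr rfl fun k _ => Finset.sum_congr rfl fun l _ => ?_
      simp only [RCLike.inner_apply, conj_trivial]
      ring
    simp_rw [LinearIsometryEquiv.symm_symm, he]
    rw [integral_finsetSum _ fun k _ => integrableOn_of_continuous hK (by fun_prop)]
    have hsum : ∀ k, ∫ z in K, ∑ l, (β i k * β j l) * ((z - p) k * (z - p) l) =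
        β i k * (M.mulVec (β j)) k := by
      intro k
      rw [integral_finsetSum _ fun k _ => integrableOn_of_continuous hK (by fun_prop),
        Matrix.mulVec, dotProduct, Finset.mul_sum]
      refine Finset.sum_congr rfl fun l _ => ?_
      rw [integral_const_mul]
      simp only [M, Matrix.of_apply]
      ring
    simp_rw [hsum, hβ, hM.mulVec_eigenvectorBasis, ← hβ]
    have horth : inner ℝ (β i) (β j) = if i = j then (1 : ℝ) else 0 :=
      orthonormal_iff_ite.1 β.orthonormal i j
    rw [PiLp.inner_apply] at horth
    calc ∑ k, β i k * (hM.eigenvalues j • (β j).ofLp) k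
        = hM.eigenvalues j * ∑ k, inner ℝ (β i k) (β j k) := by
          rw [Finset.mul_sum]
          refine Finset.sum_congr rfl fun k _ => ?_
          simp only [RCLike.inner_apply, conj_trivial, Pi.smul_apply, smul_eq_mul]
          ring
      _ = _ := by
          rw [horth]
          split_ifs with h
          · rw [h, mul_one]
          · rw [mul_zero]

theorem setIntegral_coord_sq_pos {n : ℕ} {A : Set (Fin n → ℝ)} (hA : IsCompact A)
    (hvol : volume A = 1) (i : Fin n) : 0 < ∫ x in A, x i * x i := by
  rw [setIntegral_pos_iff_support_of_nonneg_ae (.of_forall fun x => mul_self_nonneg _)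
    ((Continuous.continuousOn (by fun_prop)).integrableOn_compact hA)]
  have h0 : volume {x : Fin n → ℝ | x i = 0} = 0 := Measure.pi_hyperplane (fun _ => volume) i 0
  have hs : Function.support (fun x : Fin n → ℝ => x i * x i) ∩ A = A \ {x | x i = 0} := by
    ext x
    simp [and_comm]
  rw [hs, measure_sdiff_null h0, hvol]
  exact one_pos

theorem measurePreserving_diagonal {n : ℕ} {w : Fin n → ℝ} (hw : ∏ i, w i = 1) :
    MeasurePreserving (fun x : Fin n → ℝ => fun i => w i * x i) volume volume := by
  have hdet : (Matrix.diagonal w).det = 1 := by rw [Matrix.det_diagonal, hw]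
  have h := Real.smul_map_diagonal_volume_pi (D := w) (by rw [hdet]; exact one_ne_zero)
  rw [hdet, abs_one, ENNReal.ofReal_one, one_smul] at h
  refine ⟨by fun_prop, ?_⟩
  have he : (fun x : Fin n → ℝ => fun i => w i * x i) = Matrix.toLin' (Matrix.diagonal w) := by
    funext x i
    simp [Matrix.mulVec_diagonal]
  rwa [he]

/-- Stretching the principal axes of a convex body brings it into isotropic position. -/
theorem isConvexIsotropic_preimage_diagonal {n : ℕ} {A : Set (Fin n → ℝ)} (hA : IsCompact A)
    (hconv : Convex ℝ A) (hint : (interior A).Nonempty) (hvol : volume A = 1) {σ : Fin n → ℝ}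
    (hσ : ∀ i, 0 < σ i) (h1 : ∀ i, ∫ x in A, x i = 0)
    (h2 : ∀ i j, ∫ x in A, x i * x j = if i = j then σ i ^ 2 else 0) {g : ℝ} (hg : 0 < g)
    (hgn : g ^ n = ∏ i, σ i) :
    IsConvexIsotropic {z : EuclideanSpace ℝ (Fin n) | (fun i => σ i / g * z i) ∈ A} g := by
  have hw : ∏ i, σ i / g = 1 := by
    rw [Finset.prod_div_distrib, Finset.prod_const, Finset.card_univ, Fintype.card_fin, hgn]
    exact div_self (Finset.prod_pos fun i _ => hσ i).ne'
  have hne : ∀ i, σ i / g ≠ 0 := fun i => (div_pos (hσ i) hg).ne'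
  have hmp : MeasurePreserving
      (fun z : EuclideanSpace ℝ (Fin n) => fun i => σ i / g * z i) volume volume :=
    (measurePreserving_diagonal hw).comp (PiLp.volume_preserving_ofLp (Fin n))
  let Θ : EuclideanSpace ℝ (Fin n) ≃ₜ (Fin n → ℝ) :=
    { toFun := fun z i => σ i / g * z i
      invFun := fun x => WithLp.toLp 2 fun i => (σ i / g)⁻¹ * x i
      left_inv := fun z => by ext i; exact inv_mul_cancel_left₀ (hne i) (z i)
      right_inv := fun x => by ext i; exact mul_inv_cancel_left₀ (hne i) (x i)
      continuous_toFun := by fun_prop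
      continuous_invFun := by fun_prop }
  have hemb : MeasurableEmbedding
      (fun z : EuclideanSpace ℝ (Fin n) => fun i => σ i / g * z i) := Θ.measurableEmbedding
  have hchange : ∀ F : (Fin n → ℝ) → ℝ,
      ∫ z in {z : EuclideanSpace ℝ (Fin n) | (fun i => σ i / g * z i) ∈ A},
        F (fun i => σ i / g * z i) = ∫ x in A, F x := fun F =>
    hmp.setIntegral_preimage_emb hemb F A
  refine ⟨⟨?_, ?_, ?_⟩, ?_, hg, ?_, ?_⟩
  · exact Θ.isCompact_preimage.2 hA
  · intro x hx y hy a b ha hb hab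
    have := hconv hx hy ha hb hab
    rw [Set.mem_ofPred_eq]
    convert this using 1
    ext i
    simp
    ring
  · obtain ⟨x, hx⟩ := hint
    refine ⟨Θ.symm x, ?_⟩
    have : Θ ⁻¹' interior A ⊆ interior (Θ ⁻¹' A) :=
      preimage_interior_subset_interior_preimage Θ.continuous
    exact this (by simpa using hx)
  · rw [← hvol]
    exact hmp.measure_preimage hA.measurableSet.nullMeasurableSet
  · intro i
    have := hchange fun x => g / σ i * x i
    have hr : ∫ x in A, g / σ i * x i = 0 := by rw [integral_const_mul, h1, mul_zero]
    rw [hr] at this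
    rw [← this]
    congr with z
    have := (hσ i).ne'
    field_simp
  · intro i j
    have := hchange fun x => g / σ i * (g / σ j) * (x i * x j)
    have hr : ∫ x in A, g / σ i * (g / σ j) * (x i * x j) =
        g / σ i * (g / σ j) * (if i = j then σ i ^ 2 else 0) := by rw [integral_const_mul, h2]
    rw [hr] at this
    have hi := (hσ i).ne'
    have hj := (hσ j).ne'
    calc _ = _ := by
          congr with z
          field_simp
      _ = _ := this
      _ = _ := by
          split_ifs with h
          · subst h; field_simp
          · simp

/-- If all isotropic constants in dimension `n + 1` are at most `C`, then every convex body of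
volume one has a hyperplane section of volume at least `1 / (8 * C)`. -/
theorem exists_slice_of_isotropic_constant_le {n : ℕ} {C : ℝ} (hC : 0 < C)
    (h : ∀ (K : Set (EuclideanSpace ℝ (Fin (n + 1)))) (L : ℝ), IsConvexIsotropic K L → L ≤ C)
    {K : Set (EuclideanSpace ℝ (Fin (n + 1)))} (hK : IsConvexBody K) (hvol : volume K = 1) :
    ∃ φ : EuclideanSpace ℝ (Fin n) →ᵃⁱ[ℝ] EuclideanSpace ℝ (Fin (n + 1)),
      ENNReal.ofReal (1 / (8 * C)) ≤ volume (φ ⁻¹' K) := by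
  obtain ⟨R, p, d, hd1, hd2⟩ := exists_rotation_diagonal_covariance hK.1 hvol
  set A : Set (Fin (n + 1) → ℝ) := {x | R (WithLp.toLp 2 x) + p ∈ K} with hA
  have hAc : IsCompact A := isCompact_preimage_rotation_add hK.1 R p
  have hmp := measurePreserving_rotation_add R p
  have hemb := measurableEmbedding_rotation_add R p
  have hvA : volume A = 1 := by
    rw [← hvol]; exact hmp.measure_preimage hK.1.measurableSet.nullMeasurableSet
  have hchange : ∀ F : EuclideanSpace ℝ (Fin (n + 1)) → ℝ,
      ∫ x in A, F (WithLp.toLp 2 x) = ∫ z in K, F (R.symm (z - p)) := by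
    intro F
    rw [← hmp.setIntegral_preimage_emb hemb]
    simp only [add_sub_cancel_right, LinearIsometryEquiv.symm_apply_apply]
    rfl
  have h1 : ∀ i, ∫ x in A, x i = 0 := fun i => (hchange fun z => z i).trans (hd1 i)
  have h2 : ∀ i j, ∫ x in A, x i * x j = if i = j then d i else 0 := fun i j =>
    (hchange fun z => z i * z j).trans (hd2 i j)
  have hdpos : ∀ i, 0 < d i := by
    intro i
    have := setIntegral_coord_sq_pos hAc hvA i
    rwa [h2, if_pos rfl] at this
  have hint : (interior A).Nonempty := by
    obtain ⟨z, hz⟩ := hK.2.2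
    have hcont : Continuous fun x : Fin (n + 1) → ℝ => R (WithLp.toLp 2 x) + p := by fun_prop
    exact ⟨(R.symm (z - p)).ofLp,
      preimage_interior_subset_interior_preimage hcont (by simpa using hz)⟩
  set g : ℝ := (∏ i, √(d i)) ^ (((n + 1 : ℕ) : ℝ)⁻¹) with hg
  have hprod : 0 < ∏ i, √(d i) := Finset.prod_pos fun i _ => Real.sqrt_pos.2 (hdpos i)
  have hgpos : 0 < g := Real.rpow_pos_of_pos hprod _
  have hgn : g ^ (n + 1) = ∏ i, √(d i) := Real.rpow_inv_natCast_pow hprod.le (by simp)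
  have hgC : g ≤ C := h _ _ <| isConvexIsotropic_preimage_diagonal hAc
    (convex_preimage_rotation_add hK.2.1 R p) hint hvA (fun i => Real.sqrt_pos.2 (hdpos i)) h1
    (fun i j => by rw [h2, Real.sq_sqrt (hdpos i).le]) hgpos hgn
  obtain ⟨i, hi⟩ : ∃ i, √(d i) ≤ g := by
    by_contra! hlt
    have := Finset.prod_lt_prod_of_nonempty (s := Finset.univ) (fun _ _ => hgpos)
      (fun i _ => hlt i) Finset.univ_nonempty
    rw [Finset.prod_const, Finset.card_univ, Fintype.card_fin, hgn] at this
    exact this.false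
  have hdi : d i ≤ C ^ 2 := by
    rw [← Real.sq_sqrt (hdpos i).le]
    exact pow_le_pow_left₀ (Real.sqrt_nonneg _) (hi.trans hgC) 2
  obtain ⟨t, ht⟩ := exists_le_volume_slice hAc.measurableSet hvA i hC (by
    rw [← ofReal_integral_eq_lintegral_ofReal
      ((Continuous.continuousOn (by fun_prop)).integrableOn_compact hAc)
      (.of_forall fun _ => sq_nonneg _)]
    simp_rw [sq (_ : ℝ)] at hdi ⊢
    rw [h2, if_pos rfl]
    exact ENNReal.ofReal_le_ofReal hdi)
  let φ : EuclideanSpace ℝ (Fin n) →ᵃⁱ[ℝ] EuclideanSpace ℝ (Fin (n + 1)) :=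
    { toFun := fun y =>
        R (insertZero i y + WithLp.toLp 2 (i.insertNth (α := fun _ => ℝ) t 0)) + p
      linear := (R.toLinearIsometry.comp (insertZero i)).toLinearMap
      map_vadd' := fun y v => by simp [add_assoc]
      norm_map := fun y => (R.toLinearIsometry.comp (insertZero i)).norm_map y }
  refine ⟨φ, ht.trans_eq ?_⟩
  have hcl : MeasurableSet (φ ⁻¹' K) := (hK.1.isClosed.preimage φ.continuous).measurableSet
  rw [← (PiLp.volume_preserving_toLp (Fin n)).measure_preimage hcl.nullMeasurableSet]
  congr 1
  ext y
  change _ ↔ R (insertZero i (WithLp.toLp 2 y) +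
    WithLp.toLp 2 (i.insertNth (α := fun _ => ℝ) t 0)) + p ∈ K
  rw [insertZero_add_toLp, add_zero]
  rfl

end

/-- The slicing conjecture is equivalent to the boundedness of the isotropic constants:
(i) there is a universal `c > 0` such that every convex body `K ⊂ ℝⁿ` (`n ≥ 1`) of
volume `1` admits an affine hyperplane section of `(n-1)`-dimensional volume at least
`c` — hyperplane sections are encoded as preimages of `K` under affine isometries
`φ : ℝ^{n-1} → ℝⁿ`, whose ranges are exactly the affine hyperplanes of `ℝⁿ`, the
`(n-1)`-dimensional volume of `K ∩ range φ` being the Lebesgue measure of `φ ⁻¹' K`;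
(ii) `sup_{n ≥ 1} Lₙ < +∞`. -/
theorem slicing_iff_bounded_isotropic_constant :
    (∃ c : ℝ, 0 < c ∧
      ∀ n : ℕ, 1 ≤ n → ∀ K : Set (EuclideanSpace ℝ (Fin n)),
        IsConvexBody K → volume K = 1 →
        ∃ φ : EuclideanSpace ℝ (Fin (n - 1)) →ᵃⁱ[ℝ] EuclideanSpace ℝ (Fin n),
          ENNReal.ofReal c ≤ volume (φ ⁻¹' K)) ↔
    (∃ C : ℝ, ∀ n : ℕ, 1 ≤ n → ∀ (K : Set (EuclideanSpace ℝ (Fin n))) (L : ℝ),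
        IsConvexIsotropic K L → L ≤ C) := by
  constructor
  · rintro ⟨c, hc, h⟩
    refine ⟨13 / c, fun n hn K L hK => ?_⟩
    obtain ⟨m, rfl⟩ := Nat.exists_eq_add_of_le' hn
    obtain ⟨φ, hφ⟩ := h (m + 1) hn K hK.1 hK.2.1
    exact isotropic_constant_le_of_slice hK hc φ hφ
  · rintro ⟨C, h⟩
    have hC : 0 < max C 1 := lt_max_of_lt_right one_pos
    refine ⟨1 / (8 * max C 1), by positivity, fun n hn K hK hvol => ?_⟩
    obtain ⟨m, rfl⟩ := Nat.exists_eq_add_of_le' hn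
    exact exists_slice_of_isotropic_constant_le hC
      (fun K L hKL => (h (m + 1) hn K L hKL).trans (le_max_left _ _)) hK hvol

end
end

section
/- One has sup_{n ≥ 1} Lₙ < +∞ if and only if sup_{n ≥ 1} L̃ₙ < +∞. -/
open MeasureTheory ProbabilityTheory

noncomputable section

/-- A nonnegative function is log-concave if it satisfies
`f(t x + (1-t) y) ≥ f(x)^t f(y)^(1-t)`; this is equivalent to `f = e^{-V}`
for some convex function `V : ℝⁿ → ℝ ∪ {+∞}`. -/
def IsLogConcaveFun {E : Type*} [AddCommGroup E] [Module ℝ E] (f : E → ℝ) : Prop :=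
  (∀ x, 0 ≤ f x) ∧
  ∀ x y : E, ∀ t : ℝ, 0 ≤ t → t ≤ 1 →
    f x ^ t * f y ^ (1 - t) ≤ f (t • x + (1 - t) • y)

/-- A measure on `ℝⁿ` is log-concave (with density) if it has a log-concave
density with respect to the Lebesgue measure. -/
def IsLogConcaveMeasure {n : ℕ} (μ : Measure (EuclideanSpace ℝ (Fin n))) : Prop :=
  ∃ f : EuclideanSpace ℝ (Fin n) → ℝ, IsLogConcaveFun f ∧
    μ = volume.withDensity fun x => ENNReal.ofReal (f x)

/-- A measure on `ℝⁿ` is isotropic if it has mean `0` and covariance matrix `Iₙ`. -/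
def IsIsotropicMeasure {n : ℕ} (μ : Measure (EuclideanSpace ℝ (Fin n))) : Prop :=
  (∀ i, ∫ x, x i ∂μ = 0) ∧
  (∀ i j, ∫ x, x i * x j ∂μ = if i = j then 1 else 0)


lemma IsLogConcaveFun.convex_superlevel {E : Type*} [AddCommGroup E] [Module ℝ E] {f : E → ℝ}
    (hf : IsLogConcaveFun f) {s : ℝ} (hs : 0 < s) : Convex ℝ {x | s ≤ f x} := by
  intro x hx y hy a b ha hb hab
  obtain rfl : b = 1 - a := by linarith
  have h1 : s ^ a ≤ f x ^ a := Real.rpow_le_rpow hs.le hx ha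
  have h2 : s ^ (1 - a) ≤ f y ^ (1 - a) := Real.rpow_le_rpow hs.le hy hb
  calc s = s ^ a * s ^ (1 - a) := by rw [← Real.rpow_add hs]; simp
    _ ≤ f x ^ a * f y ^ (1 - a) :=
        mul_le_mul h1 h2 (Real.rpow_nonneg hs.le _) (Real.rpow_nonneg (hf.1 _) _)
    _ ≤ _ := hf.2 x y a ha (by linarith)

lemma IsLogConcaveFun.pi {ι E : Type*} [Fintype ι] [AddCommGroup E] [Module ℝ E] {f : E → ℝ}
    (hf : IsLogConcaveFun f) : IsLogConcaveFun fun x : ι → E => ∏ i, f (x i) := by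
  refine ⟨fun x => Finset.prod_nonneg fun i _ => hf.1 _, fun x y t ht ht1 => ?_⟩
  simp only [Pi.add_apply, Pi.smul_apply]
  rw [← Real.finsetProd_rpow _ _ (fun i _ => hf.1 _),
    ← Real.finsetProd_rpow _ _ (fun i _ => hf.1 _),
    ← Finset.prod_mul_distrib]
  exact Finset.prod_le_prod (fun i _ => mul_nonneg (Real.rpow_nonneg (hf.1 _) _)
    (Real.rpow_nonneg (hf.1 _) _)) fun i _ => hf.2 _ _ t ht ht1

lemma IsLogConcaveFun.comp_linearMap {E F : Type*} [AddCommGroup E] [Module ℝ E] [AddCommGroup F]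
    [Module ℝ F] {f : E → ℝ} (hf : IsLogConcaveFun f) (g : F →ₗ[ℝ] E) :
    IsLogConcaveFun fun x => f (g x) :=
  ⟨fun x => hf.1 _, fun x y t ht ht1 => by simpa using hf.2 (g x) (g y) t ht ht1⟩

lemma IsLogConcaveFun.const_mul {E : Type*} [AddCommGroup E] [Module ℝ E] {f : E → ℝ}
    (hf : IsLogConcaveFun f) {c : ℝ} (hc : 0 < c) : IsLogConcaveFun fun x => c * f x := by
  refine ⟨fun x => mul_nonneg hc.le (hf.1 x), fun x y t ht ht1 => ?_⟩
  rw [Real.mul_rpow hc.le (hf.1 x), Real.mul_rpow hc.le (hf.1 y)]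
  calc c ^ t * f x ^ t * (c ^ (1 - t) * f y ^ (1 - t))
      = (c ^ t * c ^ (1 - t)) * (f x ^ t * f y ^ (1 - t)) := by ring
    _ = c * (f x ^ t * f y ^ (1 - t)) := by rw [← Real.rpow_add hc]; simp
    _ ≤ _ := mul_le_mul_of_nonneg_left (hf.2 x y t ht ht1) hc.le

lemma IsLogConcaveFun.indicator {E : Type*} [AddCommGroup E] [Module ℝ E] {f : E → ℝ}
    (hf : IsLogConcaveFun f) {s : Set E} (hs : Convex ℝ s) : IsLogConcaveFun (s.indicator f) := by
  classical
  refine ⟨fun x => Set.indicator_nonneg (fun x _ => hf.1 x) x, fun x y t ht ht1 => ?_⟩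
  have nn : ∀ z, 0 ≤ s.indicator f z := Set.indicator_nonneg (fun x _ => hf.1 x)
  rcases ht.eq_or_lt with rfl | ht0
  · simp
  rcases ht1.eq_or_lt with rfl | ht1'
  · simp
  by_cases hx : x ∈ s
  · by_cases hy : y ∈ s
    · have hz : t • x + (1 - t) • y ∈ s := hs hx hy ht (by linarith) (by ring)
      simpa [hx, hy, hz] using hf.2 x y t ht ht1
    · rw [Set.indicator_of_notMem hy, Real.zero_rpow (by linarith), mul_zero]
      exact nn _
  · rw [Set.indicator_of_notMem hx, Real.zero_rpow (by linarith), zero_mul]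
    exact nn _

lemma IsLogConcaveFun.aemeasurable {E : Type*} [NormedAddCommGroup E] [NormedSpace ℝ E]
    [MeasurableSpace E] [BorelSpace E] [FiniteDimensional ℝ E] {f : E → ℝ}
    (hf : IsLogConcaveFun f) (μ : Measure E) [μ.IsAddHaarMeasure] : AEMeasurable f μ := by
  have h : NullMeasurable f μ := by
    refine measurable_of_Ici (δ := NullMeasurableSpace E μ) fun s => ?_
    rcases le_or_gt s 0 with hs | hs
    · convert MeasurableSet.univ
      ext x
      simp only [Set.mem_univ, iff_true]
      exact hs.trans (hf.1 x)
    · exact (hf.convex_superlevel hs).nullMeasurableSet μ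
  exact h.aemeasurable

lemma IsLogConcaveFun.sqrt_mul_integral_le {E : Type*} [NormedAddCommGroup E] [NormedSpace ℝ E]
    [MeasurableSpace E] [BorelSpace E] [FiniteDimensional ℝ E] {f : E → ℝ}
    (hf : IsLogConcaveFun f) (μ : Measure E) [μ.IsAddHaarMeasure] (hi : Integrable f μ)
    (hs : Integrable (fun x => √(f x)) μ) (p : E) :
    √(f p) * ∫ x, √(f x) ∂μ ≤ 2 ^ Module.finrank ℝ E * ∫ x, f x ∂μ := by
  have key : ∀ x, √(f p) * √(f x) ≤ f ((1 / 2 : ℝ) • (x + p)) := by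
    intro x
    have := hf.2 x p (1 / 2) (by norm_num) (by norm_num)
    rw [Real.sqrt_eq_rpow, Real.sqrt_eq_rpow, mul_comm, smul_add]
    norm_num at this ⊢
    exact this
  have e : ∫ x, f ((1 / 2 : ℝ) • (x + p)) ∂μ = 2 ^ Module.finrank ℝ E * ∫ x, f x ∂μ := by
    rw [integral_add_right_eq_self (fun x => f ((1 / 2 : ℝ) • x)) p, Measure.integral_comp_smul]
    simp
  rw [← integral_const_mul, ← e]
  refine integral_mono (hs.const_mul _) ?_ key
  have := (hi.comp_smul (R := (1/2 : ℝ)) (by norm_num)).comp_add_right p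
  exact this

lemma integrableOn_of_isBounded_of_continuous {E : Type*} [NormedAddCommGroup E] [NormedSpace ℝ E]
    [MeasurableSpace E] [BorelSpace E] [FiniteDimensional ℝ E] {μ : Measure E}
    [IsLocallyFiniteMeasure μ] {K : Set E} (hK : Bornology.IsBounded K) {h : E → ℝ}
    (hh : Continuous h) : IntegrableOn h K μ :=
  haveI := FiniteDimensional.proper ℝ E
  (hh.continuousOn.integrableOn_compact hK.isCompact_closure).mono_set subset_closure

/-- The variance of a linear functional on a convex body is at least a polynomial (in the
dimension) fraction of its squared width. -/
lemma Convex.mul_sq_le_setIntegral_sq {E : Type*} [NormedAddCommGroup E] [NormedSpace ℝ E]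
    [MeasurableSpace E] [BorelSpace E] [FiniteDimensional ℝ E] {μ : Measure E}
    [μ.IsAddHaarMeasure] {K : Set E} (hK : Convex ℝ K) (hb : Bornology.IsBounded K)
    (hd : 1 ≤ Module.finrank ℝ E) (l : E →L[ℝ] ℝ) {p q : E} (hp : p ∈ K) (hq : q ∈ K) (t : ℝ) :
    μ.real K * (l p - l q) ^ 2 / (32 * (Module.finrank ℝ E : ℝ) ^ 2) ≤
      ∫ x in K, (l x - t) ^ 2 ∂μ := by
  set d := Module.finrank ℝ E
  have hd0 : (1 : ℝ) ≤ d := by exact_mod_cast hd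
  set a : ℝ := 1 / (2 * d) with ha
  have ha0 : 0 < a := by positivity
  have ha1 : a ≤ 1 / 2 := by
    rw [ha, div_le_div_iff₀ (by positivity) (by norm_num)]; linarith
  have hpow : 1 / 2 ≤ (1 - a) ^ d := by
    have := one_add_mul_le_pow (a := -a) (by linarith) d
    have e : (d : ℝ) * -a = -(1 / 2) := by rw [ha]; field_simp
    rw [e] at this
    calc (1 / 2 : ℝ) = 1 + -(1 / 2) := by norm_num
      _ ≤ _ := this
      _ = _ := by ring
  have hnull : NullMeasurableSet K μ := hK.nullMeasurableSet μ
  set G : E → ℝ := K.indicator fun x => (l x - t) ^ 2 with hG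
  have hGi : Integrable G μ := by
    exact (integrableOn_of_isBounded_of_continuous hb (by fun_prop)).integrable_indicator₀ hnull
  have key : ∀ r ∈ K, 1 / 2 * ∫ x in K, (l ((1 - a) • x + a • r) - t) ^ 2 ∂μ ≤
      ∫ x in K, (l x - t) ^ 2 ∂μ := by
    intro r hr
    have e1 : ∫ x, G ((1 - a) • x + a • r) ∂μ = ((1 - a) ^ d)⁻¹ * ∫ x, G x ∂μ := by
      rw [Measure.integral_comp_smul μ (fun x => G (x + a • r)),
        integral_add_right_eq_self (fun x => G x) (a • r), abs_of_nonneg]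
      · simp [d]
      · have : 0 ≤ 1 - a := by linarith
        positivity
    have e2 : ∫ x in K, (l ((1 - a) • x + a • r) - t) ^ 2 ∂μ ≤ ∫ x, G ((1 - a) • x + a • r) ∂μ := by
      rw [← integral_indicator₀ hnull]
      refine integral_mono ?_ ?_ ?_
      · exact (integrableOn_of_isBounded_of_continuous hb (by fun_prop)).integrable_indicator₀ hnull
      · exact (hGi.comp_add_right (a • r)).comp_smul (R := 1 - a) (by linarith)
      · intro x
        by_cases hx : x ∈ K
        · have : (1 - a) • x + a • r ∈ K := hK hx hr (by linarith) ha0.le (by ring)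
          simp [hG, hx, this]
        · rw [Set.indicator_of_notMem hx]
          exact Set.indicator_nonneg (fun x _ => sq_nonneg _) _
    rw [e1, hG, integral_indicator₀ hnull] at e2
    have h0 : 0 < (1 - a) ^ d := by linarith
    rw [inv_mul_eq_div, le_div_iff₀ h0] at e2
    refine le_trans ?_ e2
    rw [mul_comm]
    exact mul_le_mul_of_nonneg_left hpow (integral_nonneg fun x => sq_nonneg _)
  have i1 : ∀ r : E, IntegrableOn (fun x => (l ((1 - a) • x + a • r) - t) ^ 2) K μ := fun r =>
    integrableOn_of_isBounded_of_continuous hb (by fun_prop)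
  have sum : μ.real K * (a ^ 2 * (l p - l q) ^ 2 / 2) ≤
      ∫ x in K, (l ((1 - a) • x + a • p) - t) ^ 2 ∂μ +
        ∫ x in K, (l ((1 - a) • x + a • q) - t) ^ 2 ∂μ := by
    rw [← integral_add (i1 p) (i1 q), ← smul_eq_mul, ← setIntegral_const]
    refine setIntegral_mono_on₀ ?_ ((i1 p).add (i1 q)) hnull fun x _ => ?_
    · exact integrableOn_of_isBounded_of_continuous hb continuous_const
    · simp only [map_add, map_smul, smul_eq_mul]
      nlinarith [sq_nonneg (((1 - a) * l x + a * l p - t) + ((1 - a) * l x + a * l q - t))]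
  have hk := add_le_add (key p hp) (key q hq)
  have : μ.real K * (l p - l q) ^ 2 / (32 * (d : ℝ) ^ 2) =
      1 / 4 * (μ.real K * (a ^ 2 * (l p - l q) ^ 2 / 2)) := by
    rw [ha]; field_simp; ring
  linarith

/-- Second moment of a centred empirical sum under a product density. -/
lemma integral_sq_sum_mul_prod {ι E : Type*} [Fintype ι] [MeasureSpace E]
    [SigmaFinite (volume : Measure E)] {g h : E → ℝ} (hg : Integrable g)
    (hgh : Integrable fun x => h x * g x) (hghh : Integrable fun x => h x ^ 2 * g x)
    (h1 : ∫ x, g x = 1) (h0 : ∫ x, h x * g x = 0) :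
    Integrable (fun x : ι → E => (∑ i, h (x i)) ^ 2 * ∏ i, g (x i)) ∧
    ∫ x : ι → E, (∑ i, h (x i)) ^ 2 * ∏ i, g (x i) = Fintype.card ι * ∫ x, h x ^ 2 * g x := by
  classical
  set G : ι → ι → ι → E → ℝ := fun i j k x =>
    (if k = i then h x else 1) * (if k = j then h x else 1) * g x with hG
  have hterm : ∀ (x : ι → E), (∑ i, h (x i)) ^ 2 * ∏ i, g (x i) =
      ∑ i, ∑ j, ∏ k, G i j k (x k) := by
    intro x
    rw [sq, Finset.sum_mul_sum, Finset.sum_mul]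
    refine Finset.sum_congr rfl fun i _ => ?_
    rw [Finset.sum_mul]
    refine Finset.sum_congr rfl fun j _ => ?_
    simp only [hG, Finset.prod_mul_distrib]
    simp
  have hGi : ∀ i j k, Integrable (G i j k) := by
    intro i j k
    simp only [hG]
    split_ifs
    · simpa [← sq] using hghh
    · simpa using hgh
    · simpa using hgh
    · simpa using hg
  have hint : ∀ i j, Integrable fun x : ι → E => ∏ k, G i j k (x k) := fun i j =>
    Integrable.fintype_prod_dep (fun k => hGi i j k)
  simp_rw [hterm]
  refine ⟨integrable_finsetSum _ fun i _ => integrable_finsetSum _ fun j _ => hint i j, ?_⟩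
  rw [integral_finsetSum _ fun i _ => integrable_finsetSum _ fun j _ => hint i j]
  have hij : ∀ i j, ∫ x : ι → E, ∏ k, G i j k (x k) = if i = j then ∫ x, h x ^ 2 * g x else 0 := by
    intro i j
    rw [integral_fintype_prod_volume_eq_prod]
    split_ifs with hij
    · subst hij
      rw [Finset.prod_eq_single i]
      · simp [hG, sq]
      · intro k _ hk
        simp [hG, hk, h1]
      · simp
    · refine Finset.prod_eq_zero (Finset.mem_univ i) ?_
      simp [hG, hij, h0]
  simp_rw [integral_finsetSum _ fun j _ => hint _ j, hij]
  simp

lemma lintegral_min_eq_setLIntegral_measure_superlevel {X : Type*} [MeasurableSpace X]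
    {μ : Measure X} {F : X → ℝ} (hF : AEMeasurable F μ) (F0 : ∀ x, 0 ≤ F x) {t : ℝ} (ht : 0 ≤ t) :
    ∫⁻ x, ENNReal.ofReal (min (F x) t) ∂μ = ∫⁻ s in Set.Ioc 0 t, μ {x | s ≤ F x} := by
  rw [lintegral_eq_lintegral_meas_le μ (Filter.Eventually.of_forall fun x => le_min (F0 x) ht)
    (hF.min aemeasurable_const), ← Set.Ioc_union_Ioi_eq_Ioi ht,
    lintegral_union measurableSet_Ioi (Set.Ioc_disjoint_Ioi le_rfl)]
  have h2 : ∫⁻ s in Set.Ioi t, μ {x | s ≤ min (F x) t} = 0 := by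
    rw [setLIntegral_congr_fun (g := fun _ => 0) measurableSet_Ioi]
    · simp
    · intro s hs
      have : {x | s ≤ min (F x) t} = ∅ := by
        ext x
        simp only [le_min_iff, Set.mem_ofPred_eq, Set.mem_empty_iff_false, iff_false, not_and,
          not_le]
        exact fun _ => hs
      simp only [this, measure_empty]
  rw [h2, add_zero]
  refine setLIntegral_congr_fun measurableSet_Ioc fun s hs => ?_
  have : {x | s ≤ min (F x) t} = {x | s ≤ F x} := by
    ext x
    simp only [le_min_iff, Set.mem_ofPred_eq, and_iff_left_iff_imp]
    exact fun _ => hs.2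
  simp only [this]

/-- A probability density has a superlevel set, at an intermediate level, on which a given function
with small mean has small mean. -/
lemma exists_superlevel_setLIntegral_le {X : Type*} [MeasurableSpace X]
    {μ : Measure X} {F : X → ℝ} (hF : AEMeasurable F μ) (F0 : ∀ x, 0 ≤ F x)
    (hn : ∀ s, 0 < s → NullMeasurableSet {x | s ≤ F x} μ)
    (h1 : ∫⁻ x, ENNReal.ofReal (F x) ∂μ = 1) {M : ℝ} (hM0 : 0 ≤ M) (hM : ∀ x, F x ≤ M) {s₀ : ℝ}
    (hs₀ : 0 < s₀) (hB : ∫⁻ x, ENNReal.ofReal (min (F x) s₀) ∂μ ≤ 1 / 2) {Φ : X → ENNReal}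
    (hΦ : Measurable Φ) {τ : ENNReal} (hτ : τ ≠ 0) (hτ' : τ ≠ ⊤)
    (hΦF : ∫⁻ x, Φ x * ENNReal.ofReal (F x) ∂μ ≤ τ) :
    ∃ s, s₀ < s ∧ s ≤ 3 / 4 * M ∧ μ {x | s ≤ F x} ≠ 0 ∧
      ∫⁻ x in {x | s ≤ F x}, Φ x ∂μ ≤ 8 * τ * μ {x | s ≤ F x} := by
  by_contra! hcon
  have hmass : 1 / 4 ≤ ∫⁻ s in Set.Ioc s₀ (3 / 4 * M), μ {x | s ≤ F x} := by
    have h34 : (3 / 4 : ENNReal) ≤ ∫⁻ s in Set.Ioc 0 (3 / 4 * M), μ {x | s ≤ F x} := by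
      rw [← lintegral_min_eq_setLIntegral_measure_superlevel hF F0 (by positivity)]
      calc (3 / 4 : ENNReal) = ENNReal.ofReal (3 / 4) * ∫⁻ x, ENNReal.ofReal (F x) ∂μ := by
            rw [h1, mul_one, ENNReal.ofReal_div_of_pos (by norm_num)]; simp
        _ = ∫⁻ x, ENNReal.ofReal (3 / 4) * ENNReal.ofReal (F x) ∂μ :=
            (lintegral_const_mul'' _ hF.ennreal_ofReal).symm
        _ ≤ _ := by
            refine lintegral_mono fun x => ?_
            rw [← ENNReal.ofReal_mul (by norm_num)]
            refine ENNReal.ofReal_le_ofReal (le_min ?_ ?_)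
            · have := F0 x; linarith
            · have := hM x; linarith
    rw [lintegral_min_eq_setLIntegral_measure_superlevel hF F0 hs₀.le] at hB
    have hsub : Set.Ioc 0 (3 / 4 * M) ⊆ Set.Ioc 0 s₀ ∪ Set.Ioc s₀ (3 / 4 * M) := by
      intro s hs
      rcases le_or_gt s s₀ with h | h
      · exact Or.inl ⟨hs.1, h⟩
      · exact Or.inr ⟨h, hs.2⟩
    have hle := (lintegral_mono_set (f := fun s => μ {x | s ≤ F x}) (μ := volume) hsub).trans
      (lintegral_union_le _ _ _)
    have h3 : (3 / 4 : ENNReal) ≤ 1 / 2 + ∫⁻ s in Set.Ioc s₀ (3 / 4 * M), μ {x | s ≤ F x} :=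
      h34.trans (hle.trans (add_le_add_left hB _))
    have h4 : (3 / 4 : ENNReal) = 1 / 2 + 1 / 4 := by
      rw [← ENNReal.toReal_eq_toReal_iff' (by finiteness) (by finiteness),
        ENNReal.toReal_add (by finiteness) (by finiteness)]
      norm_num
    rw [h4] at h3
    exact (ENNReal.add_le_add_iff_left (by finiteness)).1 h3
  have hup : ∫⁻ s in Set.Ioc s₀ (3 / 4 * M), 8 * τ * μ {x | s ≤ F x} ≤ τ := by
    calc ∫⁻ s in Set.Ioc s₀ (3 / 4 * M), 8 * τ * μ {x | s ≤ F x}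
        ≤ ∫⁻ s in Set.Ioc s₀ (3 / 4 * M), μ.withDensity Φ {x | s ≤ F x} := by
          refine setLIntegral_mono' measurableSet_Ioc fun s hs => ?_
          rw [withDensity_apply₀ _ (hn s (hs₀.trans hs.1))]
          by_cases h0 : μ {x | s ≤ F x} = 0
          · simp [h0]
          · exact (hcon s hs.1 hs.2 h0).le
      _ ≤ ∫⁻ s in Set.Ioi 0, μ.withDensity Φ {x | s ≤ F x} :=
          lintegral_mono_set fun s hs => hs₀.trans hs.1
      _ = ∫⁻ x, ENNReal.ofReal (F x) ∂(μ.withDensity Φ) :=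
          (lintegral_eq_lintegral_meas_le _ (Filter.Eventually.of_forall F0)
            (hF.mono_ac (withDensity_absolutelyContinuous _ _))).symm
      _ = ∫⁻ x, Φ x * ENNReal.ofReal (F x) ∂μ := by
          rw [lintegral_withDensity_eq_lintegral_mul₀ hΦ.aemeasurable hF.ennreal_ofReal]
          rfl
      _ ≤ τ := hΦF
  rw [lintegral_const_mul' _ _ (by finiteness)] at hup
  have h5 : 8 * τ * (1 / 4) ≤ τ := (mul_le_mul_right hmass _).trans hup
  have h6 : 8 * τ.toReal * (1 / 4) ≤ τ.toReal := by
    have := (ENNReal.toReal_le_toReal (by finiteness) hτ').2 h5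
    simpa using this
  have := ENNReal.toReal_pos hτ hτ'
  linarith

/-- The isotropic constants of convex bodies in convex isotropic position are at most `C`. -/
def BodyConstantLE (C : ℝ) : Prop :=
  ∀ n : ℕ, 1 ≤ n → ∀ (K : Set (EuclideanSpace ℝ (Fin n))) (L : ℝ), IsConvexIsotropic K L → L ≤ C

lemma BodyConstantLE.le_of_pi {C : ℝ} (hC : BodyConstantLE C) {ι : Type*} [Fintype ι] [Nonempty ι]
    [DecidableEq ι] {K : Set (ι → ℝ)} (hK : IsCompact K) (hc : Convex ℝ K) (hv : volume K = 1)
    {a : ℝ} (ha : 0 < a) (h1 : ∀ i, ∫ x in K, x i = 0)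
    (h2 : ∀ i j, ∫ x in K, x i * x j = if i = j then a ^ 2 else 0) : a ≤ C := by
  let e : ι ≃ Fin (Fintype.card ι) := Fintype.equivFin ι
  let T : EuclideanSpace ℝ (Fin (Fintype.card ι)) ≃L[ℝ] (ι → ℝ) :=
    (PiLp.continuousLinearEquiv 2 ℝ fun _ : Fin (Fintype.card ι) => ℝ).trans
      (ContinuousLinearEquiv.piCongrLeft ℝ (fun _ : ι => ℝ) e.symm)
  have hT : ∀ x i, T x i = x (e i) := fun x i => by
    obtain ⟨j, rfl⟩ := e.symm.surjective i
    change (Equiv.piCongrLeft (fun _ : ι => ℝ) e.symm) _ _ = _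
    rw [Equiv.piCongrLeft_apply_apply]
    simp
  have hmp : MeasurePreserving T volume volume :=
    (volume_measurePreserving_piCongrLeft (fun _ : ι => ℝ) e.symm).comp
      (PiLp.volume_preserving_ofLp _)
  have hme : MeasurableEmbedding T := T.toHomeomorph.measurableEmbedding
  refine hC _ Fintype.card_pos (T ⁻¹' K) a ⟨⟨?_, ?_, ?_⟩, ?_, ha, ?_, ?_⟩
  · exact T.toHomeomorph.isClosedEmbedding.isCompact_preimage hK
  · exact hc.linear_preimage T.toLinearMap
  · have : (interior K).Nonempty := by
      by_contra hne
      rw [Set.not_nonempty_iff_eq_empty] at hne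
      have := hc.addHaar_frontier volume
      rw [frontier, hK.isClosed.closure_eq, hne, Set.sdiff_empty, hv] at this
      exact one_ne_zero this
    obtain ⟨z, hz⟩ := this
    refine ⟨T.symm z, ?_⟩
    exact preimage_interior_subset_interior_preimage T.continuous (by simpa using hz)
  · rw [hmp.measure_preimage hK.measurableSet.nullMeasurableSet, hv]
  · intro i
    have := hmp.setIntegral_preimage_emb hme (fun x => x (e.symm i)) K
    simpa [hT, h1] using this
  · intro i j
    have := hmp.setIntegral_preimage_emb hme (fun x => x (e.symm i) * x (e.symm j)) K
    simpa [hT, h2] using this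

lemma BodyConstantLE.det_le {C : ℝ} (hC : BodyConstantLE C) {ι : Type*} [Fintype ι] [Nonempty ι]
    [DecidableEq ι] {K : Set (ι → ℝ)} (hK : Convex ℝ K) (hb : Bornology.IsBounded K)
    (hv : volume K ≠ 0) {b : ι → ℝ} {S : Matrix ι ι ℝ} (h1 : ∀ i, ∫ x in K, (x i - b i) = 0)
    (h2 : ∀ i j, ∫ x in K, (x i - b i) * (x j - b j) = volume.real K * S i j) :
    S.det ≤ C ^ (2 * Fintype.card ι) * volume.real K ^ 2 := by
  have hfin : volume K ≠ ⊤ := hb.measure_lt_top.ne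
  have hvp : 0 < volume.real K := ENNReal.toReal_pos hv hfin
  have hint : ∀ h : (ι → ℝ) → ℝ, Continuous h → IntegrableOn h K volume := fun h hh =>
    integrableOn_of_isBounded_of_continuous hb hh
  have hpsd : S.PosSemidef := by
    refine Matrix.PosSemidef.of_dotProduct_mulVec_nonneg ?_ fun u => ?_
    · ext i j
      have := (h2 j i).symm.trans ((integral_congr_ae (ae_of_all _ fun x => mul_comm _ _)).trans
        (h2 i j))
      simpa using mul_left_cancel₀ hvp.ne' this
    · have key : volume.real K * (star u ⬝ᵥ S.mulVec u) =
          ∫ x in K, (∑ i, u i * (x i - b i)) ^ 2 := by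
        simp only [sq, Finset.sum_mul_sum]
        rw [integral_finsetSum]
        · simp only [dotProduct, Matrix.mulVec, Finset.mul_sum]
          refine Finset.sum_congr rfl fun i _ => ?_
          rw [integral_finsetSum]
          · refine Finset.sum_congr rfl fun j _ => ?_
            rw [show (fun x : ι → ℝ => u i * (x i - b i) * (u j * (x j - b j))) =
              fun x => (u i * u j) * ((x i - b i) * (x j - b j)) by ext x; ring,
              integral_const_mul, h2]
            simp only [Pi.star_apply, star_trivial]
            ring
          · exact fun j _ => hint _ (by fun_prop)
        · exact fun i _ => hint _ (by fun_prop)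
      have : 0 ≤ volume.real K * (star u ⬝ᵥ S.mulVec u) := by
        rw [key]; exact integral_nonneg fun x => sq_nonneg _
      exact nonneg_of_mul_nonneg_right this hvp
  rcases le_or_gt S.det 0 with hdet | hdet
  · exact hdet.trans (by rw [pow_mul]; positivity)
  obtain ⟨B, hB⟩ : ∃ B : Matrix ι ι ℝ, S = B.transpose * B := by
    open scoped MatrixOrder in
    obtain ⟨B, hB⟩ := CStarAlgebra.nonneg_iff_eq_star_mul_self.1
      (Matrix.nonneg_iff_posSemidef.2 hpsd)
    exact ⟨B, by simpa [Matrix.star_eq_conjTranspose] using hB⟩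
  have hdS : S.det = B.det ^ 2 := by rw [hB, Matrix.det_mul, Matrix.det_transpose, sq]
  have hB0 : B.det ≠ 0 := fun h => by rw [hdS, h] at hdet; simp at hdet
  obtain ⟨a, ha, had⟩ : ∃ a : ℝ, 0 < a ∧ a ^ Fintype.card ι = |B.det| / volume.real K := by
    refine ⟨(|B.det| / volume.real K) ^ ((Fintype.card ι : ℝ)⁻¹), by positivity, ?_⟩
    rw [Real.rpow_inv_natCast_pow (by positivity) Fintype.card_ne_zero]
  have haC : a ≤ C := by
    set M : Matrix ι ι ℝ := a⁻¹ • B.transpose with hM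
    set W : Matrix ι ι ℝ := a • (B⁻¹).transpose with hW
    have hWM : W * M = 1 := by
      rw [hW, hM, Matrix.smul_mul, Matrix.mul_smul, smul_smul, mul_inv_cancel₀ ha.ne', one_smul,
        ← Matrix.transpose_mul, Matrix.mul_nonsing_inv _ (Ne.isUnit hB0), Matrix.transpose_one]
    have hWS : W * S * W.transpose = (a ^ 2) • (1 : Matrix ι ι ℝ) := by
      rw [hW, hB, Matrix.transpose_smul, Matrix.transpose_transpose, Matrix.smul_mul,
        Matrix.smul_mul, Matrix.mul_smul, smul_smul, ← sq]
      congr 1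
      rw [← Matrix.mul_assoc, ← Matrix.transpose_mul, Matrix.mul_nonsing_inv _ (Ne.isUnit hB0),
        Matrix.transpose_one, Matrix.one_mul, Matrix.mul_nonsing_inv _ (Ne.isUnit hB0)]
    have hdM : |M.det| = volume.real K := by
      rw [hM, Matrix.det_smul, Matrix.det_transpose, abs_mul, abs_of_pos (by positivity), inv_pow,
        had, inv_div, div_mul_cancel₀ _ (abs_ne_zero.2 hB0)]
    have hdM0 : M.det ≠ 0 := fun h => by rw [h, abs_zero] at hdM; exact hvp.ne hdM
    let φ : (ι → ℝ) → ι → ℝ := fun y => b + Matrix.toLin' M y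
    have hφc : Continuous φ := by
      have := (Matrix.toLin' M).continuous_of_finiteDimensional
      fun_prop
    have hφm : Measure.map φ volume = ENNReal.ofReal (volume.real K)⁻¹ • volume := by
      have : φ = (fun x => b + x) ∘ Matrix.toLin' M := rfl
      rw [this, ← Measure.map_map (measurable_const_add b)
        (Matrix.toLin' M).continuous_of_finiteDimensional.measurable,
        Real.map_matrix_volume_pi_eq_smul_volume_pi hdM0, Measure.map_smul, map_add_left_eq_self,
        abs_inv, hdM]
    have hφW : ∀ y i, y i = ∑ j, W i j * (φ y j - b j) := fun y i => by
      have : W.mulVec (M.mulVec y) = y := by rw [Matrix.mulVec_mulVec, hWM, Matrix.one_mulVec]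
      conv_lhs => rw [← this]
      simp [φ, Matrix.mulVec, dotProduct]
    have hae : closure K =ᵐ[volume] K := by
      refine (ae_eq_set.2 ⟨?_, ?_⟩)
      · refine measure_mono_null ?_ (hK.addHaar_frontier volume)
        rintro x ⟨hx, hx'⟩
        exact ⟨hx, fun h => hx' (interior_subset h)⟩
      · rw [Set.sdiff_eq_empty.2 subset_closure, measure_empty]
    have hcm : MeasurableSet (closure K) := isClosed_closure.measurableSet
    have hI : ∀ h : (ι → ℝ) → ℝ, Continuous h →
        ∫ y in φ ⁻¹' closure K, h (φ y) = (volume.real K)⁻¹ * ∫ x in K, h x := fun h hh => by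
      rw [← setIntegral_map hcm hh.aestronglyMeasurable hφc.measurable.aemeasurable, hφm,
        Measure.restrict_smul, integral_smul_measure, setIntegral_congr_set hae,
        ENNReal.toReal_ofReal (by positivity), smul_eq_mul]
    refine hC.le_of_pi (K := φ ⁻¹' closure K) ?_ ?_ ?_ ha (fun i => ?_) fun i j => ?_
    · let ψ : (ι → ℝ) → ι → ℝ := fun x => Matrix.toLin' W (x - b)
      have hψ : ∀ y, ψ (φ y) = y := fun y => by
        ext i
        rw [hφW y i]
        simp [ψ, Matrix.mulVec, dotProduct]
      have hψc : Continuous ψ := by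
        have := (Matrix.toLin' W).continuous_of_finiteDimensional
        fun_prop
      refine (hb.isCompact_closure.image hψc).of_isClosed_subset
        (isClosed_closure.preimage hφc) fun y hy => ⟨φ y, hy, hψ y⟩
    · intro x hx y hy s t hs ht hst
      have : φ (s • x + t • y) = s • φ x + t • φ y := by
        simp only [φ, map_add, map_smul, smul_add]
        nth_rewrite 1 [← one_smul ℝ b]
        rw [← hst, add_smul]
        abel
      rw [Set.mem_preimage, this]
      exact hK.closure hx hy hs ht hst
    · rw [← Measure.map_apply hφc.measurable hcm, hφm, Measure.smul_apply, measure_congr hae,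
        smul_eq_mul, ENNReal.ofReal_inv_of_pos hvp, measureReal_def, ENNReal.ofReal_toReal hfin,
        ENNReal.inv_mul_cancel hv hfin]
    · calc ∫ y in φ ⁻¹' closure K, y i
          = ∫ y in φ ⁻¹' closure K, ∑ j, W i j * (φ y j - b j) := by simp_rw [← hφW]
        _ = (volume.real K)⁻¹ * ∫ x in K, ∑ j, W i j * (x j - b j) :=
            hI (fun x => ∑ j, W i j * (x j - b j)) (by fun_prop)
        _ = 0 := by
            rw [integral_finsetSum _ fun j _ => hint _ (by fun_prop)]
            simp [integral_const_mul, h1]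
    · calc ∫ y in φ ⁻¹' closure K, y i * y j
          = ∫ y in φ ⁻¹' closure K, (∑ k, W i k * (φ y k - b k)) * ∑ l, W j l * (φ y l - b l) := by
            simp_rw [← hφW]
        _ = (volume.real K)⁻¹ * ∫ x in K, (∑ k, W i k * (x k - b k)) * ∑ l, W j l * (x l - b l) :=
            hI (fun x => (∑ k, W i k * (x k - b k)) * ∑ l, W j l * (x l - b l)) (by fun_prop)
        _ = (volume.real K)⁻¹ * ∑ k, ∑ l, W i k * W j l * (volume.real K * S k l) := by
            simp only [Finset.sum_mul_sum]
            rw [integral_finsetSum _ fun k _ => hint _ (by fun_prop)]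
            congr 1
            refine Finset.sum_congr rfl fun k _ => ?_
            rw [integral_finsetSum _ fun l _ => hint _ (by fun_prop)]
            refine Finset.sum_congr rfl fun l _ => ?_
            rw [← h2, ← integral_const_mul]
            exact integral_congr_ae (ae_of_all _ fun x => by ring)
        _ = (W * S * W.transpose) i j := by
            simp only [Matrix.mul_apply, Matrix.transpose_apply, Finset.sum_mul, Finset.mul_sum]
            rw [Finset.sum_comm]
            refine Finset.sum_congr rfl fun l _ => Finset.sum_congr rfl fun k _ => ?_
            field_simp
        _ = if i = j then a ^ 2 else 0 := by rw [hWS]; simp [Matrix.one_apply]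
  have : |B.det| = a ^ Fintype.card ι * volume.real K := by rw [had]; field_simp
  rw [hdS, ← sq_abs, this, mul_pow, ← pow_mul, mul_comm (Fintype.card ι)]
  gcongr

lemma Matrix.PosSemidef.det_le_det {ι : Type*} [Fintype ι] [DecidableEq ι] {Q S : Matrix ι ι ℝ}
    (hQ : Q.PosSemidef) (h : (S - Q).PosSemidef) : Q.det ≤ S.det := by
  have hS : S.PosSemidef := by simpa using h.add hQ
  obtain ⟨B, hB⟩ : ∃ B : Matrix ι ι ℝ, Q = B.conjTranspose * B := by
    open scoped MatrixOrder in
    obtain ⟨B, hB⟩ := CStarAlgebra.nonneg_iff_eq_star_mul_self.1 (Matrix.nonneg_iff_posSemidef.2 hQ)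
    exact ⟨B, by simpa [Matrix.star_eq_conjTranspose] using hB⟩
  have hdQ : Q.det = B.det ^ 2 := by
    rw [hB, Matrix.det_mul, Matrix.det_conjTranspose, sq, star_trivial]
  by_cases hB0 : B.det = 0
  · rw [hdQ, hB0]
    simpa using hS.det_nonneg
  have hBu : IsUnit B.det := Ne.isUnit hB0
  set P : Matrix ι ι ℝ := (B⁻¹).conjTranspose * (S - Q) * B⁻¹ with hP
  have hPp : P.PosSemidef := h.conjTranspose_mul_mul_same B⁻¹
  have h1P : (1 + P).IsHermitian := Matrix.isHermitian_one.add hPp.1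
  have hSP : S = B.conjTranspose * (1 + P) * B := by
    have e1 : B.conjTranspose * (B⁻¹).conjTranspose = 1 := by
      rw [← Matrix.conjTranspose_mul, Matrix.nonsing_inv_mul _ hBu, Matrix.conjTranspose_one]
    rw [Matrix.mul_add, Matrix.add_mul, Matrix.mul_one, ← hB, hP, ← Matrix.mul_assoc,
      ← Matrix.mul_assoc, e1, Matrix.one_mul, Matrix.mul_assoc, Matrix.nonsing_inv_mul _ hBu,
      Matrix.mul_one]
    abel
  have hge : 1 ≤ (1 + P).det := by
    rw [h1P.det_eq_prod_eigenvalues]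
    refine Finset.one_le_prod fun i _ => ?_
    have hv : ∑ k, (h1P.eigenvectorBasis i) k ^ 2 = 1 := by
      have := h1P.eigenvectorBasis.orthonormal.1 i
      rw [EuclideanSpace.norm_eq, Real.sqrt_eq_one] at this
      simpa using this
    rw [RCLike.ofReal_real_eq_id, id, h1P.eigenvalues_eq, Matrix.add_mulVec, dotProduct_add,
      Matrix.one_mulVec, map_add, RCLike.re_to_real, RCLike.re_to_real]
    have h0 := hPp.dotProduct_mulVec_nonneg (h1P.eigenvectorBasis i).ofLp
    have h1 : star (h1P.eigenvectorBasis i).ofLp ⬝ᵥ (h1P.eigenvectorBasis i).ofLp = 1 := by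
      simpa [dotProduct, sq] using hv
    linarith
  rw [hSP, Matrix.det_mul, Matrix.det_mul, Matrix.det_conjTranspose, hdQ, star_trivial]
  nlinarith [sq_nonneg B.det]

lemma volume_preserving_curry {ι κ : Type*} [Fintype ι] [Fintype κ] :
    MeasurePreserving (MeasurableEquiv.curry ι κ ℝ) volume volume := by
  refine MeasurePreserving.symm (MeasurableEquiv.curry ι κ ℝ).symm
    ⟨MeasurableEquiv.measurable _, (Measure.pi_eq fun s hs => ?_).symm⟩
  rw [Measure.map_apply (MeasurableEquiv.measurable _) (MeasurableSet.univ_pi hs)]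
  have : (MeasurableEquiv.curry ι κ ℝ).symm ⁻¹' Set.pi Set.univ s =
      Set.pi Set.univ fun i => Set.pi Set.univ fun a => s (i, a) := by
    ext x
    simp [Set.mem_pi, Function.uncurry]
  rw [this, volume_pi_pi]
  simp_rw [volume_pi_pi]
  rw [Fintype.prod_prod_type]

lemma det_smul_one_add_smul_one {ι : Type*} [Fintype ι] [Nonempty ι] [DecidableEq ι] {c d : ℝ}
    (hc : c ≠ 0) : (c • (1 : Matrix ι ι ℝ) + d • Matrix.of fun _ _ => 1).det =
      c ^ (Fintype.card ι - 1) * (c + Fintype.card ι * d) := by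
  have : c • (1 : Matrix ι ι ℝ) + d • (Matrix.of fun _ _ => 1) =
      c • (1 + Matrix.replicateCol Unit (fun _ : ι => d / c) *
        Matrix.replicateRow Unit fun _ : ι => (1 : ℝ)) := by
    ext i j
    simp [Matrix.mul_apply, Matrix.one_apply, mul_add, mul_div_cancel₀ _ hc]
  obtain ⟨k, hk⟩ := Nat.exists_eq_succ_of_ne_zero (Fintype.card_ne_zero (α := ι))
  rw [this, Matrix.det_smul, Matrix.det_one_add_replicateCol_mul_replicateRow]
  simp only [dotProduct, one_mul, Finset.sum_const, Finset.card_univ, nsmul_eq_mul, hk,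
    Nat.succ_sub_one, pow_succ]
  field_simp

lemma BodyConstantLE.pow_le_of_le_setIntegral_sq {C : ℝ} (hC : BodyConstantLE C) {ι κ : Type*}
    [Fintype ι] [Fintype κ] [Nonempty ι] [Nonempty κ] {K : Set (ι → κ → ℝ)} (hK : Convex ℝ K)
    (hb : Bornology.IsBounded K) (hv : volume K ≠ 0) {b : κ → ℝ}
    (h1 : ∀ i a, ∫ x in K, (x i a - b a) = 0) {c e : ℝ} (hc : 0 < c) (he : 0 ≤ e)
    (h2 : ∀ u : ι → κ → ℝ, volume.real K * (c * ∑ i, ∑ a, u i a ^ 2 +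
      (e - c) / Fintype.card ι * ∑ a, (∑ i, u i a) ^ 2) ≤
        ∫ x in K, (∑ i, ∑ a, u i a * (x i a - b a)) ^ 2) :
    (c ^ (Fintype.card ι - 1) * e) ^ Fintype.card κ ≤
      C ^ (2 * (Fintype.card ι * Fintype.card κ)) * volume.real K ^ 2 := by
  classical
  have hN : (0 : ℝ) < Fintype.card ι := by exact_mod_cast Fintype.card_pos
  have hfin : volume K ≠ ⊤ := hb.measure_lt_top.ne
  have hvp : 0 < volume.real K := ENNReal.toReal_pos hv hfin
  let T : (ι × κ → ℝ) ≃L[ℝ] (ι → κ → ℝ) := (LinearEquiv.curry ℝ ℝ ι κ).toContinuousLinearEquiv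
  have hmp : MeasurePreserving T volume volume := volume_preserving_curry
  have hme : MeasurableEmbedding T := T.toHomeomorph.measurableEmbedding
  have hTK : volume (T ⁻¹' K) = volume K := hmp.measure_preimage_emb hme K
  have hTKr : volume.real (T ⁻¹' K) = volume.real K := by simp only [measureReal_def, hTK]
  have hbT : Bornology.IsBounded (T ⁻¹' K) := by
    have := T.symm.lipschitz.isBounded_image hb
    rwa [T.symm.image_eq_preimage_symm] at this
  have hint : ∀ h : (ι × κ → ℝ) → ℝ, Continuous h → IntegrableOn h (T ⁻¹' K) volume := fun h hh =>
    integrableOn_of_isBounded_of_continuous hbT hh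
  let S : Matrix (ι × κ) (ι × κ) ℝ := Matrix.of fun p q =>
    (volume.real K)⁻¹ * ∫ x in T ⁻¹' K, (x p - b p.2) * (x q - b q.2)
  let A : Matrix ι ι ℝ := c • 1 + ((e - c) / Fintype.card ι) • Matrix.of fun _ _ => 1
  let Q : Matrix (ι × κ) (ι × κ) ℝ := Matrix.kronecker A 1
  have hQdet : Q.det = (c ^ (Fintype.card ι - 1) * e) ^ Fintype.card κ := by
    rw [show Q = Matrix.kroneckerMap (fun x y => x * y) A 1 from rfl, Matrix.det_kronecker,
      Matrix.det_one, one_pow, mul_one, det_smul_one_add_smul_one hc.ne']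
    congr 2
    field_simp
    ring
  have hQu : ∀ u : ι × κ → ℝ, u ⬝ᵥ Q.mulVec u = c * ∑ i, ∑ a, u (i, a) ^ 2 +
      (e - c) / Fintype.card ι * ∑ a, (∑ i, u (i, a)) ^ 2 := by
    intro u
    have : ∀ i a, Q.mulVec u (i, a) = c * u (i, a) + (e - c) / Fintype.card ι * ∑ j, u (j, a) := by
      intro i a
      simp [Q, A, Matrix.mulVec, dotProduct, Fintype.sum_prod_type, Matrix.one_apply, add_mul,
        Finset.sum_add_distrib, Finset.mul_sum]
    simp only [dotProduct, Fintype.sum_prod_type, this, mul_add, Finset.sum_add_distrib]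
    congr 1
    · simp only [Finset.mul_sum]
      exact Finset.sum_congr rfl fun i _ => Finset.sum_congr rfl fun a _ => by ring
    · rw [Finset.sum_comm, Finset.mul_sum]
      refine Finset.sum_congr rfl fun a _ => ?_
      rw [← Finset.sum_mul]
      ring
  have hSu : ∀ u : ι × κ → ℝ, u ⬝ᵥ S.mulVec u =
      (volume.real K)⁻¹ * ∫ x in K, (∑ i, ∑ a, u (i, a) * (x i a - b a)) ^ 2 := by
    intro u
    have e1 : ∫ x in K, (∑ i, ∑ a, u (i, a) * (x i a - b a)) ^ 2 =
        ∫ x in T ⁻¹' K, (∑ p, u p * (x p - b p.2)) ^ 2 := by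
      have := hmp.setIntegral_preimage_emb hme
        (fun x => (∑ i, ∑ a, u (i, a) * (x i a - b a)) ^ 2) K
      rw [← this]
      simp only [Fintype.sum_prod_type]
      rfl
    rw [e1]
    simp only [sq, Finset.sum_mul_sum]
    rw [integral_finsetSum _ fun p _ => hint _ (by fun_prop)]
    simp only [dotProduct, Matrix.mulVec, Finset.mul_sum]
    refine Finset.sum_congr rfl fun p _ => ?_
    rw [integral_finsetSum _ fun q _ => hint _ (by fun_prop), Finset.mul_sum]
    refine Finset.sum_congr rfl fun q _ => ?_
    simp only [S, Matrix.of_apply]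
    rw [show (fun x : ι × κ → ℝ => u p * (x p - b p.2) * (u q * (x q - b q.2))) =
      fun x => (u p * u q) * ((x p - b p.2) * (x q - b q.2)) by ext x; ring, integral_const_mul]
    ring
  have hSh : S.IsHermitian := by
    ext p q
    simp only [S, Matrix.conjTranspose_apply, Matrix.of_apply, star_trivial]
    simp_rw [mul_comm]
  have hQh : Q.IsHermitian := by
    ext p q
    simp [Q, A, Matrix.one_apply, eq_comm]
  have hQp : Q.PosSemidef := by
    refine Matrix.PosSemidef.of_dotProduct_mulVec_nonneg hQh fun u => ?_
    rw [star_trivial, hQu]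
    have : ∑ a, (∑ i, u (i, a)) ^ 2 ≤ Fintype.card ι * ∑ i, ∑ a, u (i, a) ^ 2 := by
      rw [Finset.sum_comm, Finset.mul_sum]
      exact Finset.sum_le_sum fun a _ => by
        simpa using sq_sum_le_card_mul_sum_sq (s := Finset.univ) (f := fun i => u (i, a))
    have h0 : 0 ≤ ∑ a, (∑ i, u (i, a)) ^ 2 := Finset.sum_nonneg fun a _ => sq_nonneg _
    have h3 : (e - c) / Fintype.card ι * ∑ a, (∑ i, u (i, a)) ^ 2 =
      e / Fintype.card ι * ∑ a, (∑ i, u (i, a)) ^ 2 -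
        c * ((∑ a, (∑ i, u (i, a)) ^ 2) / Fintype.card ι) := by
      ring
    have h4 : (∑ a, (∑ i, u (i, a)) ^ 2) / Fintype.card ι ≤ ∑ i, ∑ a, u (i, a) ^ 2 := by
      rwa [div_le_iff₀' hN]
    have h5 : 0 ≤ e / Fintype.card ι * ∑ a, (∑ i, u (i, a)) ^ 2 := by positivity
    rw [h3]
    nlinarith
  have hSQ : (S - Q).PosSemidef := by
    refine Matrix.PosSemidef.of_dotProduct_mulVec_nonneg (hSh.sub hQh) fun u => ?_
    rw [star_trivial, Matrix.sub_mulVec, dotProduct_sub, hSu, hQu, sub_nonneg, inv_mul_eq_div,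
      le_div_iff₀' hvp]
    exact h2 fun i a => u (i, a)
  have hfinal := hC.det_le (K := T ⁻¹' K) (b := fun p => b p.2) (S := S)
    (hK.linear_preimage T.toLinearMap) hbT (by rwa [hTK]) (fun p => ?_) fun p q => ?_
  · rw [← hQdet, ← Fintype.card_prod, ← hTKr]
    exact (hQp.det_le_det hSQ).trans hfinal
  · have := hmp.setIntegral_preimage_emb hme (fun x => x p.1 p.2 - b p.2) K
    rw [h1] at this
    exact this
  · simp only [S, Matrix.of_apply, hTKr]
    field_simp

lemma LinearMap.BilinForm.le_sum_add_of_exchangeable {ι κ : Type*} [Fintype ι] [Fintype κ]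
    [Nonempty ι] (d β : LinearMap.BilinForm ℝ (κ → ℝ)) {c e : ℝ}
    (hd : ∀ θ : κ → ℝ, c * ∑ a, θ a ^ 2 ≤ d θ θ)
    (he : ∀ θ : κ → ℝ, e * ∑ a, θ a ^ 2 ≤ d θ θ + Fintype.card ι * β θ θ) (u : ι → κ → ℝ) :
    c * ∑ i, ∑ a, u i a ^ 2 + (e - c) / Fintype.card ι * ∑ a, (∑ i, u i a) ^ 2 ≤
      ∑ i, d (u i) (u i) + β (∑ i, u i) (∑ i, u i) := by
  have hN : (0 : ℝ) < Fintype.card ι := by exact_mod_cast Fintype.card_pos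
  set w : κ → ℝ := (Fintype.card ι : ℝ)⁻¹ • ∑ i, u i with hw
  have hsum : ∑ i, u i = (Fintype.card ι : ℝ) • w := by
    rw [hw, smul_smul, mul_inv_cancel₀ hN.ne', one_smul]
  have hsa : ∀ a, ∑ i, u i a = Fintype.card ι * w a := fun a => by
    have := congrFun hsum a
    simpa using this
  have h1 := Finset.sum_le_sum fun i (_ : i ∈ Finset.univ) => hd (u i - w)
  have h2 : ∑ i, d (u i - w) (u i - w) = ∑ i, d (u i) (u i) - Fintype.card ι * d w w := by
    have e1 : ∑ i, d (u i) w = Fintype.card ι * d w w := by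
      rw [← LinearMap.sum_apply, ← map_sum, hsum, LinearMap.map_smul₂, smul_eq_mul]
    have e2 : ∑ i, d w (u i) = Fintype.card ι * d w w := by
      rw [← map_sum, hsum, map_smul, smul_eq_mul]
    simp only [map_sub, LinearMap.sub_apply, Finset.sum_sub_distrib, e1, e2]
    simp
  have h3 : ∑ i, c * ∑ a, (u i - w) a ^ 2 =
      c * ∑ i, ∑ a, u i a ^ 2 - c * (Fintype.card ι * ∑ a, w a ^ 2) := by
    rw [← Finset.mul_sum (f := fun i => ∑ a, (u i - w) a ^ 2), Finset.sum_comm,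
      Finset.sum_comm (f := fun i a => u i a ^ 2), ← mul_sub,
      Finset.mul_sum (f := fun a => w a ^ 2), ← Finset.sum_sub_distrib]
    congr 1
    refine Finset.sum_congr rfl fun a _ => ?_
    have : ∑ i, (u i - w) a ^ 2 = ∑ i, u i a ^ 2 - 2 * w a * ∑ i, u i a +
        Fintype.card ι * w a ^ 2 := by
      rw [Finset.mul_sum, ← Finset.sum_sub_distrib, ← nsmul_eq_mul, ← Finset.card_univ,
        ← Finset.sum_const, ← Finset.sum_add_distrib]
      exact Finset.sum_congr rfl fun i _ => by simp only [Pi.sub_apply]; ring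
    rw [this, hsa]
    ring
  have h4 : (e - c) / Fintype.card ι * ∑ a, (∑ i, u i a) ^ 2 =
      Fintype.card ι * (e * ∑ a, w a ^ 2) - c * (Fintype.card ι * ∑ a, w a ^ 2) := by
    simp only [hsa, mul_pow, ← Finset.mul_sum]
    field_simp
  have h5 : β (∑ i, u i) (∑ i, u i) = Fintype.card ι * (Fintype.card ι * β w w) := by
    rw [hsum]
    simp
  have h6 := mul_le_mul_of_nonneg_left (he w) hN.le
  rw [h2, h3] at h1
  rw [h4, h5]
  linarith

lemma BodyConstantLE.pow_le_of_symmetric {C : ℝ} (hC : BodyConstantLE C) {ι κ : Type*}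
    [Fintype ι] [Fintype κ] [Nontrivial ι] [Nonempty κ] {K : Set (ι → κ → ℝ)} (hK : Convex ℝ K)
    (hb : Bornology.IsBounded K) (hv : volume K ≠ 0)
    (hsymm : ∀ (σ : Equiv.Perm ι) (x : ι → κ → ℝ), (fun i => x (σ i)) ∈ K ↔ x ∈ K)
    {c e : ℝ} (hc : 0 < c) (he : 0 ≤ e) (m : κ → ℝ)
    (h1 : ∀ θ : κ → ℝ, volume.real K * (c * ∑ a, θ a ^ 2) ≤
      ∫ x in K, ((Fintype.card ι : ℝ)⁻¹ * ∑ i, (∑ a, θ a * (x i a - m a)) ^ 2 -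
        ((Fintype.card ι : ℝ)⁻¹ * ∑ i, ∑ a, θ a * (x i a - m a)) ^ 2))
    (h2 : ∀ (θ : κ → ℝ) (t : ℝ), volume.real K * (Fintype.card ι * (e * ∑ a, θ a ^ 2)) ≤
      ∫ x in K, (∑ i, ∑ a, θ a * x i a - t) ^ 2) :
    (c ^ (Fintype.card ι - 1) * e) ^ Fintype.card κ ≤
      C ^ (2 * (Fintype.card ι * Fintype.card κ)) * volume.real K ^ 2 := by
  classical
  obtain ⟨i₀, i₁, h01⟩ := exists_pair_ne ι
  have hN1 : (1 : ℝ) < Fintype.card ι := by exact_mod_cast Fintype.one_lt_card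
  have hN : (0 : ℝ) < Fintype.card ι := by linarith
  have hfin : volume K ≠ ⊤ := hb.measure_lt_top.ne
  have hvp : 0 < volume.real K := ENNReal.toReal_pos hv hfin
  have hint : ∀ h : (ι → κ → ℝ) → ℝ, Continuous h → IntegrableOn h K volume := fun h hh =>
    integrableOn_of_isBounded_of_continuous hb hh
  have hperm : ∀ (σ : Equiv.Perm ι) (h : (ι → κ → ℝ) → ℝ),
      ∫ x in K, h (fun i => x (σ i)) = ∫ x in K, h x := fun σ h => by
    let T := MeasurableEquiv.piCongrLeft (fun _ : ι => κ → ℝ) σ.symm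
    have hT : ∀ x, T x = fun i => x (σ i) := fun x => by
      ext1 i
      obtain ⟨j, rfl⟩ := σ.symm.surjective i
      change (Equiv.piCongrLeft (fun _ : ι => κ → ℝ) σ.symm) _ _ = _
      rw [Equiv.piCongrLeft_apply_apply]
      simp
    have hmp : MeasurePreserving T volume volume :=
      volume_measurePreserving_piCongrLeft (fun _ : ι => κ → ℝ) σ.symm
    have := hmp.setIntegral_preimage_emb T.measurableEmbedding h K
    have hpre : T ⁻¹' K = K := by
      ext x
      rw [Set.mem_preimage, hT, hsymm]
    rw [hpre] at this
    rw [← this]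
    simp only [hT]
  set b : κ → ℝ := fun a => (volume.real K)⁻¹ * ∫ x in K, x i₀ a with hbdef
  have hmean : ∀ i a, ∫ x in K, (x i a - b a) = 0 := fun i a => by
    rw [integral_sub (hint _ (by fun_prop)) (hint _ (by fun_prop))]
    have : ∫ x in K, x i a = ∫ x in K, x i₀ a := by
      simpa using hperm (Equiv.swap i₀ i) (fun x => x i₀ a)
    rw [this, setIntegral_const, hbdef, smul_eq_mul, mul_inv_cancel_left₀ hvp.ne', sub_self]
  let Y : (κ → ℝ) → ι → (ι → κ → ℝ) → ℝ := fun θ i x => ∑ a, θ a * (x i a - b a)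
  have hYc : ∀ θ i, Continuous (Y θ i) := fun θ i => by simp only [Y]; fun_prop
  have hYadd : ∀ θ η i x, Y (θ + η) i x = Y θ i x + Y η i x := fun θ η i x => by
    simp [Y, add_mul, Finset.sum_add_distrib]
  have hYsmul : ∀ (r : ℝ) θ i x, Y (r • θ) i x = r * Y θ i x := fun r θ i x => by
    simp [Y, Finset.mul_sum, mul_assoc]
  have hYY : ∀ θ η i j, IntegrableOn (fun x => Y θ i x * Y η j x) K volume := fun θ η i j =>
    hint _ ((hYc θ i).mul (hYc η j))
  let G : ι → ι → LinearMap.BilinForm ℝ (κ → ℝ) := fun i j =>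
    LinearMap.mk₂ ℝ (fun θ η => ∫ x in K, Y θ i x * Y η j x)
      (fun θ θ' η => by simp only [hYadd, add_mul]; exact integral_add (hYY _ _ _ _) (hYY _ _ _ _))
      (fun r θ η => by simp only [hYsmul, mul_assoc]; exact integral_const_mul _ _)
      (fun θ η η' => by simp only [hYadd, mul_add]; exact integral_add (hYY _ _ _ _) (hYY _ _ _ _))
      (fun r θ η => by simp only [hYsmul, mul_left_comm]; exact integral_const_mul _ _)
  have hG : ∀ i j θ η, G i j θ η = ∫ x in K, Y θ i x * Y η j x := fun i j θ η => rfl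
  have hGd : ∀ i θ η, G i i θ η = G i₀ i₀ θ η := fun i θ η => by
    have := hperm (Equiv.swap i₀ i) (fun x => Y θ i₀ x * Y η i₀ x)
    simp only [Y, Equiv.swap_apply_left] at this
    exact this
  have hGo : ∀ i j θ η, i ≠ j → G i j θ η = G i₀ i₁ θ η := fun i j θ η hij => by
    have := hperm (Equiv.swap i₀ i * Equiv.swap i₁ (Equiv.swap i₀ i j))
      (fun x => Y θ i₀ x * Y η i₁ x)
    have hne : i₀ ≠ Equiv.swap i₀ i j := fun h => hij <| by
      have := congrArg (Equiv.swap i₀ i) h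
      rwa [Equiv.swap_apply_self, Equiv.swap_apply_left] at this
    have k0 : (Equiv.swap i₀ i * Equiv.swap i₁ (Equiv.swap i₀ i j)) i₀ = i := by
      rw [Equiv.Perm.mul_apply, Equiv.swap_apply_of_ne_of_ne h01 hne, Equiv.swap_apply_left]
    have k1 : (Equiv.swap i₀ i * Equiv.swap i₁ (Equiv.swap i₀ i j)) i₁ = j := by
      rw [Equiv.Perm.mul_apply, Equiv.swap_apply_left, Equiv.swap_apply_self]
    simp only [Y, k0, k1] at this
    exact this
  set d := G i₀ i₀ - G i₀ i₁ with hd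
  set β := G i₀ i₁ with hβ
  have hGdb : ∀ i j θ η, G i j θ η = (if i = j then d θ η else 0) + β θ η := fun i j θ η => by
    split_ifs with h
    · subst h
      rw [hGd, hd]
      simp
    · rw [hGo i j θ η h, zero_add]
  have hsq : ∀ u : ι → κ → ℝ, ∫ x in K, (∑ i, Y (u i) i x) ^ 2 =
      ∑ i, d (u i) (u i) + β (∑ i, u i) (∑ i, u i) := fun u => by
    simp only [sq, Finset.sum_mul_sum]
    rw [integral_finsetSum _ fun i _ => integrable_finsetSum _ fun j _ => hYY _ _ _ _]
    simp only [map_sum, LinearMap.sum_apply]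
    rw [Finset.sum_comm (γ := ι), ← Finset.sum_add_distrib]
    refine Finset.sum_congr rfl fun i _ => ?_
    rw [integral_finsetSum _ fun j _ => hYY _ _ _ _]
    simp_rw [← hG, hGdb]
    rw [Finset.sum_add_distrib]
    simp
  have hsq1 : ∀ θ i, ∫ x in K, (Y θ i x) ^ 2 = d θ θ + β θ θ := fun θ i => by
    simp_rw [sq]
    rw [← hG, hGdb, if_pos rfl]
  have hsqc : ∀ θ, ∫ x in K, (∑ i, Y θ i x) ^ 2 =
      Fintype.card ι * (d θ θ + Fintype.card ι * β θ θ) := fun θ => by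
    have : ∑ _i : ι, θ = (Fintype.card ι : ℝ) • θ := by ext a; simp
    rw [hsq fun _ => θ, this, map_smul, LinearMap.map_smul₂]
    simp only [Finset.sum_const, Finset.card_univ, nsmul_eq_mul, smul_eq_mul]
    ring
  refine hC.pow_le_of_le_setIntegral_sq hK hb hv hmean hc he fun u => ?_
  have main := LinearMap.BilinForm.le_sum_add_of_exchangeable (ι := ι) d β
    (c := volume.real K * c) (e := volume.real K * e) (fun θ => ?_) (fun θ => ?_) u
  · change _ ≤ ∫ x in K, (∑ i, Y (u i) i x) ^ 2
    rw [hsq]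
    refine le_trans (le_of_eq ?_) main
    ring
  · have := h1 θ
    have hpt : ∀ x : ι → κ → ℝ, (Fintype.card ι : ℝ)⁻¹ * ∑ i, (∑ a, θ a * (x i a - m a)) ^ 2 -
        ((Fintype.card ι : ℝ)⁻¹ * ∑ i, ∑ a, θ a * (x i a - m a)) ^ 2 =
        (Fintype.card ι : ℝ)⁻¹ * ∑ i, Y θ i x ^ 2 -
          ((Fintype.card ι : ℝ)⁻¹ * ∑ i, Y θ i x) ^ 2 := by
      intro x
      have hs : ∀ i, ∑ a, θ a * (x i a - m a) = Y θ i x + ∑ a, θ a * (b a - m a) := fun i => by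
        simp only [Y, ← Finset.sum_add_distrib]
        exact Finset.sum_congr rfl fun a _ => by ring
      set t := ∑ a, θ a * (b a - m a)
      simp only [hs, add_sq, Finset.sum_add_distrib, Finset.sum_const, Finset.card_univ,
        nsmul_eq_mul, ← Finset.sum_mul, ← Finset.mul_sum]
      field_simp
      ring
    simp_rw [hpt, mul_pow] at this
    have i1 : Integrable (fun x => ∑ i, Y θ i x ^ 2) (volume.restrict K) :=
      integrable_finsetSum _ fun i _ => hint _ ((hYc θ i).pow 2)
    have i2 : Integrable (fun x => (∑ i, Y θ i x) ^ 2) (volume.restrict K) :=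
      hint _ ((continuous_finsetSum _ fun i _ => hYc θ i).pow 2)
    rw [integral_sub (i1.const_mul _) (i2.const_mul _),
      integral_const_mul, integral_const_mul, hsqc,
      integral_finsetSum (f := fun i x => Y θ i x ^ 2) _
        fun i _ => hint _ ((hYc θ i).pow 2)] at this
    simp_rw [hsq1] at this
    simp only [Finset.sum_const, Finset.card_univ, nsmul_eq_mul] at this
    have e1 : (Fintype.card ι : ℝ)⁻¹ * (Fintype.card ι * (d θ θ + β θ θ)) -
        (Fintype.card ι : ℝ)⁻¹ ^ 2 * (Fintype.card ι * (d θ θ + Fintype.card ι * β θ θ)) =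
        (1 - (Fintype.card ι : ℝ)⁻¹) * d θ θ := by
      field_simp
      ring
    rw [e1] at this
    have h0 : 0 ≤ volume.real K * (c * ∑ a, θ a ^ 2) :=
      mul_nonneg hvp.le (mul_nonneg hc.le (Finset.sum_nonneg fun a _ => sq_nonneg _))
    have hinv : (Fintype.card ι : ℝ)⁻¹ < 1 := inv_lt_one_of_one_lt₀ hN1
    have hinv0 : 0 < (Fintype.card ι : ℝ)⁻¹ := inv_pos.2 hN
    have hd0 : 0 ≤ d θ θ := nonneg_of_mul_nonneg_right (h0.trans this) (by linarith)
    nlinarith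
  · have := h2 θ (∑ i : ι, ∑ a, θ a * b a)
    simp_rw [← Finset.sum_sub_distrib, ← mul_sub] at this
    change _ ≤ ∫ x in K, (∑ i, Y θ i x) ^ 2 at this
    rw [hsqc, mul_left_comm] at this
    have := le_of_mul_le_mul_left this hN
    linarith

lemma le_of_eventually_pow_le_mul_pow {x y A : ℝ} {k : ℕ} (hy : 0 ≤ y)
    (h : ∀ᶠ N : ℕ in Filter.atTop, x ^ N ≤ A * (N ^ k * y ^ N)) : x ≤ y := by
  by_contra! hlt
  have hx0 : 0 < x := hy.trans_lt hlt
  have ht := (tendsto_pow_const_mul_const_pow_of_lt_one k (r := y / x) (by positivity)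
    ((div_lt_one hx0).2 hlt)).const_mul A
  rw [mul_zero] at ht
  obtain ⟨N, hN, hN'⟩ := (h.and (ht.eventually_lt_const one_pos)).exists
  rw [div_pow, mul_div_assoc', mul_div_assoc', div_lt_one (by positivity)] at hN'
  linarith

lemma integrable_mul_of_continuous {E : Type*} [NormedAddCommGroup E] [ProperSpace E]
    [MeasurableSpace E] [BorelSpace E] {μ : Measure E} {g h : E → ℝ} {B : Set E}
    (hB : Bornology.IsBounded B) (hgB : ∀ x ∉ B, g x = 0) (hg : Integrable g μ)
    (hh : Continuous h) : Integrable (fun x => h x * g x) μ := by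
  have hs : Function.support (fun x => h x * g x) ⊆ closure B := fun x hx => by
    by_contra hxB
    exact hx (by simp [hgB x fun h => hxB (subset_closure h)])
  rw [← integrableOn_iff_integrable_of_support_subset hs]
  exact hg.integrableOn.continuousOn_mul hh.continuousOn hB.isCompact_closure

lemma integrable_sqrt_of_isBounded {E : Type*} [NormedAddCommGroup E] [ProperSpace E]
    [MeasurableSpace E] [BorelSpace E] {μ : Measure E} [IsFiniteMeasureOnCompacts μ] {g : E → ℝ}
    (g0 : ∀ x, 0 ≤ g x) {B : Set E} (hB : Bornology.IsBounded B) (hgB : ∀ x ∉ B, g x = 0)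
    (hg : Integrable g μ) : Integrable (fun x => √(g x)) μ := by
  have hi : Integrable ((closure B).indicator fun _ => (1 : ℝ)) μ :=
    (integrable_indicator_iff isClosed_closure.measurableSet).2
      (integrableOn_const hB.isCompact_closure.measure_lt_top.ne)
  refine (hi.add hg).mono' (hg.1.aemeasurable.sqrt.aestronglyMeasurable) (ae_of_all _ fun x => ?_)
  rw [Real.norm_of_nonneg (Real.sqrt_nonneg _)]
  by_cases hx : x ∈ closure B
  · simp only [Pi.add_apply, Set.indicator_of_mem hx]
    nlinarith [Real.sq_sqrt (g0 x), Real.sqrt_nonneg (g x), sq_nonneg (√(g x) - 1)]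
  · simp [Set.indicator_of_notMem hx, hgB x fun h => hx (subset_closure h)]

lemma integral_sqrt_pos {X : Type*} [MeasurableSpace X] {μ : Measure X} {g : X → ℝ}
    (g0 : ∀ x, 0 ≤ g x) (hs : Integrable (fun x => √(g x)) μ) (h1 : ∫ x, g x ∂μ = 1) :
    0 < ∫ x, √(g x) ∂μ := by
  refine (integral_nonneg fun x => Real.sqrt_nonneg _).lt_of_ne fun h => ?_
  have h0 := (integral_eq_zero_iff_of_nonneg (fun x => Real.sqrt_nonneg _) hs).1 h.symm
  have : ∫ x, g x ∂μ = 0 := by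
    refine integral_eq_zero_of_ae ?_
    filter_upwards [h0] with x hx
    have := Real.sq_sqrt (g0 x)
    simp only [Pi.zero_apply] at hx ⊢
    rw [← this, hx]
    simp
  linarith

/-- A log-concave density comes close to its supremum on a whole ball. -/
lemma IsLogConcaveFun.exists_closedBall_le {E : Type*} [NormedAddCommGroup E] [NormedSpace ℝ E]
    [MeasurableSpace E] [BorelSpace E] [FiniteDimensional ℝ E] {g : E → ℝ}
    (hg : IsLogConcaveFun g) (μ : Measure E) [μ.IsAddHaarMeasure] (h1 : ∫ x, g x ∂μ = 1)
    {a : ℝ} {p : E} (ha : 0 ≤ a) (hp : a < g p) :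
    ∃ z : E, ∃ ρ : ℝ, 0 < ρ ∧ ∀ v : E, ‖v‖ ≤ 1 → a ≤ g (z + ρ • v) := by
  obtain ⟨k, hk⟩ : ∃ k : ℕ, μ {x | ((k : ℝ) + 1)⁻¹ ≤ g x} ≠ 0 := by
    by_contra! hcon
    have : ∫ x, g x ∂μ = 0 := by
      refine integral_eq_zero_of_ae ?_
      filter_upwards [ae_all_iff.2 fun k : ℕ => (measure_eq_zero_iff_ae_notMem.1 (hcon k))]
        with x hx
      by_contra hne
      obtain ⟨k, hk⟩ := exists_nat_one_div_lt ((hg.1 x).lt_of_ne' hne)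
      exact hx k (by simpa using hk.le)
    linarith
  have hδ : (0 : ℝ) < ((k : ℝ) + 1)⁻¹ := by positivity
  set δ := ((k : ℝ) + 1)⁻¹
  have hconv := hg.convex_superlevel hδ
  have hint : (interior {x | δ ≤ g x}).Nonempty := by
    by_contra hne
    rw [Set.not_nonempty_iff_eq_empty] at hne
    refine hk (measure_mono_null subset_closure ?_)
    have := hconv.addHaar_frontier μ
    rwa [frontier, hne, Set.sdiff_empty] at this
  obtain ⟨y, hy⟩ := hint
  obtain ⟨r, hr, hball⟩ := Metric.isOpen_iff.1 isOpen_interior y hy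
  have hcont : Filter.Tendsto (fun t : ℝ => δ ^ t * g p ^ (1 - t)) (nhds 0) (nhds (g p)) := by
    have hp0 : g p ≠ 0 := (ha.trans_lt hp).ne'
    have hc : ContinuousAt (fun t : ℝ => δ ^ t * g p ^ (1 - t)) 0 :=
      ((Real.continuousAt_const_rpow hδ.ne').mul
        ((Real.continuousAt_const_rpow hp0).comp (by fun_prop)))
    simpa [ContinuousAt] using hc
  obtain ⟨t, ht, ht0, ht1⟩ : ∃ t : ℝ, a < δ ^ t * g p ^ (1 - t) ∧ 0 < t ∧ t ≤ 1 := by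
    have h1 : ∀ᶠ t in nhdsWithin (0 : ℝ) (Set.Ioi 0), a < δ ^ t * g p ^ (1 - t) :=
      (hcont.mono_left nhdsWithin_le_nhds).eventually_const_lt hp
    obtain ⟨t, h, h'⟩ := (h1.and (Ioc_mem_nhdsGT (zero_lt_one' ℝ))).exists
    exact ⟨t, h, h'.1, h'.2⟩
  refine ⟨t • y + (1 - t) • p, t * (r / 2), by positivity, fun v hv => ?_⟩
  have hmem : y + (r / 2) • v ∈ {x | δ ≤ g x} := by
    refine interior_subset (hball ?_)
    rw [Metric.mem_ball, dist_self_add_left, norm_smul, Real.norm_of_nonneg (by positivity)]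
    nlinarith
  have := hg.2 (y + (r / 2) • v) p t ht0.le ht1
  have e : t • (y + (r / 2) • v) + (1 - t) • p = t • y + (1 - t) • p + (t * (r / 2)) • v := by
    module
  rw [e] at this
  refine le_trans (ht.le.trans ?_) this
  exact mul_le_mul_of_nonneg_right (Real.rpow_le_rpow hδ.le hmem ht0.le)
    (Real.rpow_nonneg (hg.1 _) _)

/-- Lower bound for the empirical variance in terms of the deviation of the empirical first and
second moments from `0` and `G`. -/
lemma mul_le_empirical_variance {ι κ : Type*} [Fintype ι] [Nonempty ι] [Fintype κ] (y : ι → κ → ℝ)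
    (G : κ → κ → ℝ) (θ : κ → ℝ) (hG : 1 / 4 * ∑ a, θ a ^ 2 ≤ ∑ a, ∑ b, θ a * θ b * G a b) :
    (3 / 16 - 5 * (∑ a, ((Fintype.card ι : ℝ)⁻¹ * ∑ i, y i a) ^ 2 +
      ∑ a, ∑ b, ((Fintype.card ι : ℝ)⁻¹ * ∑ i, (y i a * y i b - G a b)) ^ 2)) * ∑ a, θ a ^ 2 ≤
    (Fintype.card ι : ℝ)⁻¹ * ∑ i, (∑ a, θ a * y i a) ^ 2 -
      ((Fintype.card ι : ℝ)⁻¹ * ∑ i, ∑ a, θ a * y i a) ^ 2 := by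
  have hN : (Fintype.card ι : ℝ) ≠ 0 := by exact_mod_cast Fintype.card_ne_zero
  set e : κ → ℝ := fun a => (Fintype.card ι : ℝ)⁻¹ * ∑ i, y i a with he
  set D : κ → κ → ℝ := fun a b => (Fintype.card ι : ℝ)⁻¹ * ∑ i, (y i a * y i b - G a b) with hD
  set s := ∑ a, θ a ^ 2 with hs
  have hs0 : 0 ≤ s := Finset.sum_nonneg fun a _ => sq_nonneg _
  have h1 : (Fintype.card ι : ℝ)⁻¹ * ∑ i, ∑ a, θ a * y i a = ∑ a, θ a * e a := by
    rw [Finset.sum_comm, Finset.mul_sum]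
    refine Finset.sum_congr rfl fun a _ => ?_
    rw [he, ← Finset.mul_sum]
    ring
  have h2 : (Fintype.card ι : ℝ)⁻¹ * ∑ i, (∑ a, θ a * y i a) ^ 2 =
      ∑ a, ∑ b, θ a * θ b * G a b + ∑ a, ∑ b, θ a * θ b * D a b := by
    simp only [sq, Finset.sum_mul_sum]
    rw [Finset.sum_comm, Finset.mul_sum, ← Finset.sum_add_distrib]
    refine Finset.sum_congr rfl fun a _ => ?_
    rw [Finset.sum_comm, Finset.mul_sum, ← Finset.sum_add_distrib]
    refine Finset.sum_congr rfl fun b _ => ?_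
    have : D a b = (Fintype.card ι : ℝ)⁻¹ * ∑ i, y i a * y i b - G a b := by
      simp only [hD, Finset.sum_sub_distrib, Finset.sum_const, Finset.card_univ, nsmul_eq_mul]
      field_simp
    rw [this, show ∑ i, θ a * y i a * (θ b * y i b) = θ a * θ b * ∑ i, y i a * y i b by
      rw [Finset.mul_sum]; exact Finset.sum_congr rfl fun i _ => by ring]
    ring
  have h3 : (∑ a, θ a * e a) ^ 2 ≤ s * ∑ a, e a ^ 2 :=
    Finset.sum_mul_sq_le_sq_mul_sq _ _ _
  set D2 := ∑ a, ∑ b, D a b ^ 2 with hD2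
  have hD0 : 0 ≤ D2 := Finset.sum_nonneg fun a _ => Finset.sum_nonneg fun b _ => sq_nonneg _
  have he0 : 0 ≤ ∑ a, e a ^ 2 := Finset.sum_nonneg fun a _ => sq_nonneg _
  have h4 : (∑ a, ∑ b, θ a * θ b * D a b) ^ 2 ≤ s ^ 2 * D2 := by
    have := Finset.sum_mul_sq_le_sq_mul_sq (Finset.univ : Finset (κ × κ))
      (fun p => θ p.1 * θ p.2) (fun p => D p.1 p.2)
    simp only [Fintype.sum_prod_type] at this
    refine this.trans_eq ?_
    congr 1
    rw [hs, sq (∑ a, θ a ^ 2), Finset.sum_mul_sum]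
    simp only [mul_pow]
  rw [h1, h2]
  change (3 / 16 - 5 * (∑ a, e a ^ 2 + D2)) * s ≤ _
  clear_value D2 D e s
  have h5 : |∑ a, ∑ b, θ a * θ b * D a b| ≤ s * (1 / 16 + 4 * D2) := by
    have : D2 ≤ (1 / 16 + 4 * D2) ^ 2 := by nlinarith [sq_nonneg (1 / 16 - 4 * D2)]
    refine abs_le_of_sq_le_sq (h4.trans ?_) (mul_nonneg hs0 (by linarith))
    rw [mul_pow]
    exact mul_le_mul_of_nonneg_left this (sq_nonneg _)
  have h6 := (abs_le.1 h5).1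
  nlinarith [mul_nonneg hs0 hD0, mul_nonneg hs0 he0]

lemma integrable_prod_and_integral_eq_one {ι E : Type*} [Fintype ι] [MeasureSpace E]
    [SigmaFinite (volume : Measure E)] {g : E → ℝ} (h1 : ∫ x, g x = 1) :
    Integrable (fun x : ι → E => ∏ i, g (x i)) ∧ ∫ x : ι → E, ∏ i, g (x i) = 1 := by
  have hg : Integrable g := by
    by_contra h
    rw [integral_undef h] at h1
    exact zero_ne_one h1
  exact ⟨Integrable.fintype_prod fun _ => hg, by
    rw [integral_fintype_prod_volume_eq_prod]; simp [h1]⟩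

lemma exists_lintegral_empirical_deviation_le {κ : Type*} [Fintype κ] {g : (κ → ℝ) → ℝ}
    (g0 : ∀ x, 0 ≤ g x) {B : Set (κ → ℝ)} (hB : Bornology.IsBounded B) (hgB : ∀ x ∉ B, g x = 0)
    (h1 : ∫ x, g x = 1) {m : κ → ℝ} (hm : ∀ a, ∫ x, (x a - m a) * g x = 0) {G : κ → κ → ℝ}
    (hG : ∀ a b, ∫ x, (x a - m a) * (x b - m b) * g x = G a b) :
    ∃ A : ℝ, 0 ≤ A ∧ ∀ N : ℕ, 1 ≤ N → ∫⁻ x : Fin N → κ → ℝ, ENNReal.ofReal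
      (∑ a, ((N : ℝ)⁻¹ * ∑ i, (x i a - m a)) ^ 2 +
        ∑ a, ∑ b, ((N : ℝ)⁻¹ * ∑ i, ((x i a - m a) * (x i b - m b) - G a b)) ^ 2) *
      ENNReal.ofReal (∏ i, g (x i)) ≤ ENNReal.ofReal (A / N) := by
  have hg : Integrable g := by
    by_contra h
    rw [integral_undef h] at h1
    exact zero_ne_one h1
  have hI : ∀ h : (κ → ℝ) → ℝ, Continuous h → Integrable (fun x => h x * g x) := fun h hh =>
    integrable_mul_of_continuous hB hgB hg hh
  have key : ∀ h : (κ → ℝ) → ℝ, Continuous h → ∫ x, h x * g x = 0 → ∀ N : ℕ, 1 ≤ N →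
      Integrable (fun x : Fin N → κ → ℝ => ((N : ℝ)⁻¹ * ∑ i, h (x i)) ^ 2 * ∏ i, g (x i)) ∧
      ∫ x : Fin N → κ → ℝ, ((N : ℝ)⁻¹ * ∑ i, h (x i)) ^ 2 * ∏ i, g (x i) =
        (∫ x, h x ^ 2 * g x) / N := fun h hh h0 N hN => by
    have hN0 : (N : ℝ) ≠ 0 := by positivity
    obtain ⟨k1, k2⟩ := integral_sq_sum_mul_prod (ι := Fin N) hg (hI h hh) (hI _ (hh.pow 2)) h1 h0
    simp only [mul_pow, mul_assoc]
    refine ⟨k1.const_mul _, ?_⟩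
    rw [integral_const_mul, k2, Fintype.card_fin]
    field_simp
  refine ⟨∑ a, (∫ x, (x a - m a) ^ 2 * g x) +
    ∑ a, ∑ b, ∫ x, ((x a - m a) * (x b - m b) - G a b) ^ 2 * g x, ?_, fun N hN => ?_⟩
  · refine add_nonneg (Finset.sum_nonneg fun a _ => ?_)
      (Finset.sum_nonneg fun a _ => Finset.sum_nonneg fun b _ => ?_)
    all_goals exact integral_nonneg fun x => mul_nonneg (sq_nonneg _) (g0 x)
  · have ka := fun a => key (fun x => x a - m a) (by fun_prop) (hm a) N hN
    have kab := fun a b => key (fun x => (x a - m a) * (x b - m b) - G a b) (by fun_prop)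
      (by
        have hi := hI (fun x => (x a - m a) * (x b - m b)) (by fun_prop)
        simp_rw [sub_mul _ (G a b)]
        rw [integral_sub hi (hg.const_mul _), integral_const_mul, h1, hG, mul_one, sub_self]) N hN
    have i1 : Integrable fun x : Fin N → κ → ℝ =>
        ∑ a, ((N : ℝ)⁻¹ * ∑ i, (x i a - m a)) ^ 2 * ∏ i, g (x i) :=
      integrable_finsetSum _ fun a _ => (ka a).1
    have i2 : Integrable fun x : Fin N → κ → ℝ => ∑ a, ∑ b,
        ((N : ℝ)⁻¹ * ∑ i, ((x i a - m a) * (x i b - m b) - G a b)) ^ 2 * ∏ i, g (x i) :=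
      integrable_finsetSum _ fun a _ => integrable_finsetSum _ fun b _ => (kab a b).1
    have e : ∀ x : Fin N → κ → ℝ, (∑ a, ((N : ℝ)⁻¹ * ∑ i, (x i a - m a)) ^ 2 +
        ∑ a, ∑ b, ((N : ℝ)⁻¹ * ∑ i, ((x i a - m a) * (x i b - m b) - G a b)) ^ 2) *
        ∏ i, g (x i) = ∑ a, ((N : ℝ)⁻¹ * ∑ i, (x i a - m a)) ^ 2 * ∏ i, g (x i) + ∑ a, ∑ b,
        ((N : ℝ)⁻¹ * ∑ i, ((x i a - m a) * (x i b - m b) - G a b)) ^ 2 * ∏ i, g (x i) :=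
      fun x => by simp only [add_mul, Finset.sum_mul]
    have nn : ∀ x : Fin N → κ → ℝ, 0 ≤ ∑ a, ((N : ℝ)⁻¹ * ∑ i, (x i a - m a)) ^ 2 +
        ∑ a, ∑ b, ((N : ℝ)⁻¹ * ∑ i, ((x i a - m a) * (x i b - m b) - G a b)) ^ 2 := fun x =>
      add_nonneg (Finset.sum_nonneg fun a _ => sq_nonneg _)
        (Finset.sum_nonneg fun a _ => Finset.sum_nonneg fun b _ => sq_nonneg _)
    simp_rw [← ENNReal.ofReal_mul (nn _), e]
    have i12 : Integrable fun x : Fin N → κ → ℝ =>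
        ∑ a, ((N : ℝ)⁻¹ * ∑ i, (x i a - m a)) ^ 2 * ∏ i, g (x i) + ∑ a, ∑ b,
        ((N : ℝ)⁻¹ * ∑ i, ((x i a - m a) * (x i b - m b) - G a b)) ^ 2 * ∏ i, g (x i) :=
      i1.add i2
    rw [← ofReal_integral_eq_lintegral_ofReal i12 (ae_of_all _ fun x => ?_)]
    · refine ENNReal.ofReal_le_ofReal (le_of_eq ?_)
      rw [integral_add i1 i2, integral_finsetSum _ fun a _ => (ka a).1,
        integral_finsetSum _ fun a _ => integrable_finsetSum _ fun b _ => (kab a b).1, add_div,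
        Finset.sum_div, Finset.sum_div]
      congr 1
      · exact Finset.sum_congr rfl fun a _ => (ka a).2
      · refine Finset.sum_congr rfl fun a _ => ?_
        rw [integral_finsetSum _ fun b _ => (kab a b).1, Finset.sum_div]
        exact Finset.sum_congr rfl fun b _ => (kab a b).2
    · change 0 ≤ _ + _
      rw [← e]
      exact mul_nonneg (nn x) (Finset.prod_nonneg fun i _ => g0 _)

lemma IsLogConcaveFun.lintegral_min_prod_le {κ : Type*} [Fintype κ] {g : (κ → ℝ) → ℝ}
    (hg : IsLogConcaveFun g) (h1 : ∫ x, g x = 1) (hs : Integrable fun x => √(g x)) (p : κ → ℝ)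
    (N : ℕ) :
    ∫⁻ x : Fin N → κ → ℝ, ENNReal.ofReal
      (min (∏ i, g (x i)) (g p ^ N / (4 ^ (Fintype.card κ * N) * 4))) ≤ 1 / 2 := by
  have hgi : Integrable g := by
    by_contra h
    rw [integral_undef h] at h1
    exact zero_ne_one h1
  set s := g p ^ N / (4 ^ (Fintype.card κ * N) * 4) with hsdef
  have hs0 : 0 ≤ s := by have := hg.1 p; positivity
  have F0 : ∀ x : Fin N → κ → ℝ, 0 ≤ ∏ i, g (x i) := fun x => Finset.prod_nonneg fun i _ => hg.1 _
  have hsqrt : √s = √(g p) ^ N / (2 ^ Fintype.card κ) ^ N / 2 := by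
    rw [hsdef, Real.sqrt_div (pow_nonneg (hg.1 p) _), Real.sqrt_mul (by positivity),
      Real.sqrt_eq_iff_mul_self_eq (x := 4) (y := 2) (by norm_num) (by norm_num) |>.2 (by norm_num),
      ← div_div]
    congr 2
    · rw [Real.sqrt_eq_iff_mul_self_eq (pow_nonneg (hg.1 p) _) (by positivity), ← mul_pow,
        Real.mul_self_sqrt (hg.1 p)]
    · rw [Real.sqrt_eq_iff_mul_self_eq (by positivity) (by positivity), ← pow_mul, ← mul_pow]
      norm_num
  have hpt : ∀ x : Fin N → κ → ℝ, min (∏ i, g (x i)) s ≤ √s * ∏ i, √(g (x i)) := fun x => by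
    rw [← Real.sqrt_prod _ fun i _ => hg.1 _, ← Real.sqrt_mul hs0]
    refine Real.le_sqrt_of_sq_le ?_
    rw [sq, mul_comm s]
    exact mul_le_mul (min_le_left _ _) (min_le_right _ _) (le_min (F0 x) hs0) (F0 x)
  have hint : Integrable fun x : Fin N → κ → ℝ => √s * ∏ i, √(g (x i)) :=
    (Integrable.fintype_prod fun _ => hs).const_mul _
  calc _ ≤ ∫⁻ x : Fin N → κ → ℝ, ENNReal.ofReal (√s * ∏ i, √(g (x i))) :=
        lintegral_mono fun x => ENNReal.ofReal_le_ofReal (hpt x)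
    _ = ENNReal.ofReal (√s * (∫ x, √(g x)) ^ N) := by
        rw [← ofReal_integral_eq_lintegral_ofReal hint (ae_of_all _ fun x =>
          mul_nonneg (Real.sqrt_nonneg _) (Finset.prod_nonneg fun i _ => Real.sqrt_nonneg _)),
          integral_const_mul,
          integral_fintype_prod_volume_eq_prod (fun _ : Fin N => fun x => √(g x))]
        simp
    _ ≤ ENNReal.ofReal (1 / 2) := by
        refine ENNReal.ofReal_le_ofReal ?_
        have := hg.sqrt_mul_integral_le volume hgi hs p
        rw [h1, mul_one, Module.finrank_fintype_fun_eq_card] at this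
        rw [hsqrt, div_mul_eq_mul_div, ← div_pow, ← mul_pow]
        refine div_le_div_of_nonneg_right (pow_le_one₀ ?_ ?_) (by norm_num)
        · exact mul_nonneg (by positivity) (integral_nonneg fun x => Real.sqrt_nonneg _)
        · rwa [div_mul_eq_mul_div, div_le_one (by positivity)]
    _ = 1 / 2 := by
        rw [ENNReal.ofReal_div_of_pos (by norm_num)]; simp

lemma Convex.mul_sum_sq_le_setIntegral_sq {ι κ : Type*} [Fintype ι] [DecidableEq ι] [Fintype κ]
    [Nonempty κ] {K : Set (ι → κ → ℝ)} (hK : Convex ℝ K) (hb : Bornology.IsBounded K)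
    {p z : κ → ℝ} {ρ : ℝ} {i₀ : ι}
    (hp : ∀ v : κ → ℝ, ‖v‖ ≤ 1 → Function.update (fun _ => p) i₀ (z + ρ • v) ∈ K)
    (θ : κ → ℝ) (t : ℝ) :
    volume.real K * (ρ ^ 2 * ∑ a, θ a ^ 2) / (8 * (Fintype.card ι * Fintype.card κ) ^ 2) ≤
      ∫ x in K, (∑ i, ∑ a, θ a * x i a - t) ^ 2 := by
  rcases (Finset.sum_nonneg fun a (_ : a ∈ Finset.univ) => sq_nonneg (θ a)).eq_or_lt with h0 | h0
  · rw [← h0, mul_zero, mul_zero, zero_div]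
    exact integral_nonneg fun x => sq_nonneg _
  set S := ∑ a, θ a ^ 2 with hS
  have : Nonempty ι := ⟨i₀⟩
  have hfr : Module.finrank ℝ (ι → κ → ℝ) = Fintype.card ι * Fintype.card κ := by
    simp [Module.finrank_pi_fintype]
  let l : (ι → κ → ℝ) →L[ℝ] ℝ := ∑ i, ∑ a, θ a •
    ((ContinuousLinearMap.proj a : (κ → ℝ) →L[ℝ] ℝ).comp (ContinuousLinearMap.proj i))
  have hl : ∀ x, l x = ∑ i, ∑ a, θ a * x i a := fun x => by
    simp [l, sum_apply]
  let v : κ → ℝ := (√S)⁻¹ • θ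
  have hv : ‖v‖ ≤ 1 := by
    refine (pi_norm_le_iff_of_nonneg zero_le_one).2 fun a => ?_
    simp only [v, Pi.smul_apply, smul_eq_mul, norm_mul, norm_inv, Real.norm_eq_abs,
      abs_of_nonneg (Real.sqrt_nonneg S)]
    rw [inv_mul_le_one₀ (Real.sqrt_pos.2 h0)]
    refine Real.le_sqrt_of_sq_le ?_
    rw [sq_abs]
    exact Finset.single_le_sum (f := fun a => θ a ^ 2) (fun a _ => sq_nonneg _) (Finset.mem_univ a)
  have hdiff : l (Function.update (fun _ => p) i₀ (z + ρ • v)) -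
      l (Function.update (fun _ => p) i₀ (z + ρ • -v)) = 2 * ρ * √S := by
    rw [hl, hl, ← Finset.sum_sub_distrib, Finset.sum_eq_single i₀]
    · rw [Function.update_self, Function.update_self, ← Finset.sum_sub_distrib]
      have : ∀ a, θ a * (z + ρ • v) a - θ a * (z + ρ • -v) a = 2 * ρ * (√S)⁻¹ * θ a ^ 2 := by
        intro a
        simp only [v, Pi.add_apply, Pi.smul_apply, Pi.neg_apply, smul_eq_mul]
        ring
      simp_rw [this]
      rw [← Finset.mul_sum, ← hS]
      nth_rewrite 2 [← Real.mul_self_sqrt h0.le]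
      have := (Real.sqrt_pos.2 h0).ne'
      field_simp
    · intro i _ hi
      rw [Function.update_of_ne hi, Function.update_of_ne hi, sub_self]
    · simp
  have := hK.mul_sq_le_setIntegral_sq (μ := volume) hb
    (by rw [hfr]; exact Nat.mul_pos Fintype.card_pos Fintype.card_pos) l (hp v hv)
    (hp (-v) (by rwa [norm_neg])) t
  rw [hdiff, hfr, mul_pow, Real.sq_sqrt h0.le] at this
  simp_rw [hl] at this
  refine le_trans (le_of_eq ?_) this
  push_cast
  ring

lemma BodyConstantLE.pow_le_of_density {C : ℝ} (hC : BodyConstantLE C) {κ : Type*} [Fintype κ]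
    [Nonempty κ] {g : (κ → ℝ) → ℝ} (hg : IsLogConcaveFun g) {B : Set (κ → ℝ)}
    (hB : Bornology.IsBounded B) (hgB : ∀ x ∉ B, g x = 0) (h1 : ∫ x, g x = 1) {m : κ → ℝ}
    {G : κ → κ → ℝ} (hG : ∀ θ : κ → ℝ, 1 / 4 * ∑ a, θ a ^ 2 ≤ ∑ a, ∑ b, θ a * θ b * G a b)
    {N : ℕ} (hN : 2 ≤ N) {τ : ℝ} (hτ : 0 < τ) (hτ' : 8 * τ ≤ 1 / 80)
    (hdev : ∫⁻ x : Fin N → κ → ℝ, ENNReal.ofReal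
      (∑ a, ((N : ℝ)⁻¹ * ∑ i, (x i a - m a)) ^ 2 +
        ∑ a, ∑ b, ((N : ℝ)⁻¹ * ∑ i, ((x i a - m a) * (x i b - m b) - G a b)) ^ 2) *
      ENNReal.ofReal (∏ i, g (x i)) ≤ ENNReal.ofReal τ)
    {M : ℝ} (hM : IsLUB (Set.range g) M) {z : κ → ℝ} {ρ : ℝ}
    (hz : ∀ v : κ → ℝ, ‖v‖ ≤ 1 → 7 / 8 * M ≤ g (z + ρ • v)) {x₀ : κ → ℝ} (hx₀ : 0 < g x₀) :
    ((1 / 8) ^ (N - 1) * (ρ ^ 2 / (8 * Fintype.card κ ^ 2 * N ^ 3))) ^ Fintype.card κ ≤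
      C ^ (2 * (N * Fintype.card κ)) * (4 ^ (Fintype.card κ * N) * 4 / g x₀ ^ N) ^ 2 := by
  classical
  have hgi : Integrable g := by
    by_contra h
    rw [integral_undef h] at h1
    exact zero_ne_one h1
  have hN0 : (0 : ℝ) < N := by positivity
  have hM0 : 0 < M := hx₀.trans_le (hM.1 ⟨x₀, rfl⟩)
  have hn0 : 0 < (Fintype.card κ : ℝ) := by exact_mod_cast Fintype.card_pos
  set F : (Fin N → κ → ℝ) → ℝ := fun x => ∏ i, g (x i) with hFdef
  have hFc : IsLogConcaveFun F := hg.pi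
  obtain ⟨hFi, hF1⟩ := integrable_prod_and_integral_eq_one (ι := Fin N) h1
  have hFm : AEMeasurable F volume := hFi.1.aemeasurable
  set Ψ : (Fin N → κ → ℝ) → ℝ := fun x => ∑ a, ((N : ℝ)⁻¹ * ∑ i, (x i a - m a)) ^ 2 +
        ∑ a, ∑ b, ((N : ℝ)⁻¹ * ∑ i, ((x i a - m a) * (x i b - m b) - G a b)) ^ 2 with hΨ
  have hΨc : Continuous Ψ := by fun_prop
  have hΨ0 : ∀ x, 0 ≤ Ψ x := fun x => add_nonneg (Finset.sum_nonneg fun a _ => sq_nonneg _)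
    (Finset.sum_nonneg fun a _ => Finset.sum_nonneg fun b _ => sq_nonneg _)
  set s₀ := g x₀ ^ N / (4 ^ (Fintype.card κ * N) * 4) with hs₀
  have hs₀pos : 0 < s₀ := by positivity
  obtain ⟨s, hs, hsM, hv, hΨs⟩ := exists_superlevel_setLIntegral_le (μ := volume) hFm hFc.1
    (fun s _ => nullMeasurableSet_le aemeasurable_const hFm)
    (by rw [← ofReal_integral_eq_lintegral_ofReal hFi (ae_of_all _ hFc.1), hF1, ENNReal.ofReal_one])
    (M := M ^ N) (by positivity)
    (fun x => (Finset.prod_le_prod (fun i _ => hg.1 _) fun i _ => hM.1 ⟨x i, rfl⟩).trans (by simp))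
    hs₀pos
    (hg.lintegral_min_prod_le h1 (integrable_sqrt_of_isBounded hg.1 hB hgB hgi) x₀ N)
    (Φ := fun x => ENNReal.ofReal (Ψ x)) (hΨc.measurable.ennreal_ofReal)
    (τ := ENNReal.ofReal τ) (by simpa using hτ) ENNReal.ofReal_ne_top hdev
  have hs0 : 0 < s := hs₀pos.trans hs
  set K := {x | s ≤ F x} with hKdef
  have hKb : Bornology.IsBounded K := by
    refine (Bornology.IsBounded.pi fun _ => hB).subset fun x hx i _ => ?_
    by_contra hxi
    have h0 : F x = 0 := Finset.prod_eq_zero (Finset.mem_univ i) (hgB _ hxi)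
    exact absurd (h0 ▸ (hx : s ≤ F x)) (not_le.2 hs0)
  have hKc : Convex ℝ K := hFc.convex_superlevel hs0
  have hKsymm : ∀ (σ : Equiv.Perm (Fin N)) (x : Fin N → κ → ℝ),
      (fun i => x (σ i)) ∈ K ↔ x ∈ K := fun σ x => by
    change s ≤ ∏ i, g (x (σ i)) ↔ s ≤ ∏ i, g (x i)
    rw [Equiv.prod_comp σ fun i => g (x i)]
  have hfin : volume K ≠ ⊤ := hKb.measure_lt_top.ne
  have hKv : volume.real K ≤ 4 ^ (Fintype.card κ * N) * 4 / g x₀ ^ N := by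
    have := mul_meas_ge_le_integral_of_nonneg (ae_of_all _ hFc.1) hFi s
    rw [hF1] at this
    have h2 : volume.real K ≤ 1 / s := by rwa [le_div_iff₀' hs0]
    refine h2.trans ((one_div_le_one_div_of_le hs₀pos hs.le).trans_eq ?_)
    rw [hs₀, one_div_div]
  have hcov : ∫ x in K, Ψ x ≤ 1 / 80 * volume.real K := by
    rw [integral_eq_lintegral_of_nonneg_ae (ae_of_all _ hΨ0) hΨc.aestronglyMeasurable]
    refine ENNReal.toReal_le_of_le_ofReal (by positivity) (hΨs.trans ?_)
    rw [measureReal_def, ENNReal.ofReal_mul (by norm_num), ENNReal.ofReal_toReal hfin]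
    gcongr
    refine le_trans (le_of_eq ?_) (ENNReal.ofReal_le_ofReal hτ')
    rw [ENNReal.ofReal_mul (by norm_num)]
    simp
  obtain ⟨p, hp⟩ : ∃ p, 6 / 7 * M ^ (N - 1) ≤ g p ^ (N - 1) := by
    have hd : (1 : ℝ) / (7 * N) ≤ 1 / 7 :=
      one_div_le_one_div_of_le (by norm_num) (by
        have : (1 : ℝ) ≤ N := by exact_mod_cast (by omega : 1 ≤ N)
        linarith)
    have hd0 : (0 : ℝ) < 1 / (7 * N) := by positivity
    obtain ⟨_, ⟨p, rfl⟩, hp⟩ := (lt_isLUB_iff hM).1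
      (show M * (1 + -(1 / (7 * N))) < M by nlinarith)
    refine ⟨p, le_trans ?_ (pow_le_pow_left₀ (mul_nonneg hM0.le (by linarith)) hp.le _)⟩
    rw [mul_pow, mul_comm]
    refine mul_le_mul_of_nonneg_left (le_trans ?_ (one_add_mul_le_pow (by linarith) _))
      (by positivity)
    have : ((N - 1 : ℕ) : ℝ) * (1 / (7 * N)) ≤ 1 / 7 := by
      rw [mul_one_div, div_le_div_iff₀ (by positivity) (by norm_num)]
      have : ((N - 1 : ℕ) : ℝ) ≤ N := by exact_mod_cast Nat.sub_le _ _
      linarith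
    linarith
  let i₀ : Fin N := ⟨0, by omega⟩
  have hpK : ∀ v : κ → ℝ, ‖v‖ ≤ 1 →
      Function.update (fun _ => p) i₀ (z + ρ • v) ∈ K := fun v hv => by
    change s ≤ ∏ i, g (Function.update (fun _ => p) i₀ (z + ρ • v) i)
    have : ∀ i, g (Function.update (fun _ => p) i₀ (z + ρ • v) i) =
        Function.update (fun _ => g p) i₀ (g (z + ρ • v)) i := fun i =>
      Function.apply_update (fun _ => g) _ _ _ _
    simp_rw [this]
    rw [Finset.prod_update_of_mem (Finset.mem_univ _), Finset.prod_const, Finset.card_sdiff]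
    simp only [Finset.inter_univ, Finset.card_singleton, Finset.card_univ, Fintype.card_fin]
    calc s ≤ 3 / 4 * M ^ N := hsM
      _ = (7 / 8 * M) * (6 / 7 * M ^ (N - 1)) := by
        obtain ⟨k, rfl⟩ : ∃ k, N = k + 1 := ⟨N - 1, by omega⟩
        rw [Nat.add_sub_cancel]; ring
      _ ≤ _ := mul_le_mul (hz v hv) hp (by positivity) (hg.1 _)
  have : Nontrivial (Fin N) := Fin.nontrivial_iff_two_le.2 hN
  have hmain := hC.pow_le_of_symmetric hKc hKb hv hKsymm (c := 1 / 8)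
    (e := ρ ^ 2 / (8 * Fintype.card κ ^ 2 * N ^ 3)) (by norm_num) (by positivity) m ?_ ?_
  · rw [Fintype.card_fin] at hmain
    refine hmain.trans ?_
    have hC2 : 0 ≤ C ^ (2 * (N * Fintype.card κ)) := by rw [pow_mul]; positivity
    gcongr
  · intro θ
    have hiΨ : IntegrableOn Ψ K := integrableOn_of_isBounded_of_continuous hKb hΨc
    have hS : 0 ≤ ∑ a, θ a ^ 2 := Finset.sum_nonneg fun a _ => sq_nonneg _
    calc volume.real K * (1 / 8 * ∑ a, θ a ^ 2)
        ≤ ∫ x in K, (3 / 16 - 5 * Ψ x) * ∑ a, θ a ^ 2 := by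
          have hic : IntegrableOn (fun _ : Fin N → κ → ℝ => (3 / 16 : ℝ)) K :=
            integrableOn_const hfin
          rw [integral_mul_const, integral_sub hic (hiΨ.const_mul _),
            integral_const_mul, setIntegral_const, smul_eq_mul]
          nlinarith
      _ ≤ _ := by
          refine setIntegral_mono
            (integrableOn_of_isBounded_of_continuous hKb (by fun_prop))
            (integrableOn_of_isBounded_of_continuous hKb (by fun_prop)) fun x => ?_
          have : Nonempty (Fin N) := ⟨i₀⟩
          have := mul_le_empirical_variance (fun i a => x i a - m a) G θ (hG θ)
          simpa only [Fintype.card_fin] using this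
  · intro θ t
    refine le_trans (le_of_eq ?_) (hKc.mul_sum_sq_le_setIntegral_sq hKb hpK θ t)
    rw [Fintype.card_fin]
    field_simp

lemma BodyConstantLE.sq_le_of_isBounded {C : ℝ} (hC : BodyConstantLE C) {κ : Type*} [Fintype κ]
    [Nonempty κ] {g : (κ → ℝ) → ℝ} (hg : IsLogConcaveFun g) {B : Set (κ → ℝ)}
    (hB : Bornology.IsBounded B) (hgB : ∀ x ∉ B, g x = 0) (h1 : ∫ x, g x = 1) {m : κ → ℝ}
    (hm : ∀ a, ∫ x, (x a - m a) * g x = 0)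
    (hcov : ∀ θ : κ → ℝ, 1 / 4 * ∑ a, θ a ^ 2 ≤
      ∑ a, ∑ b, θ a * θ b * ∫ x, (x a - m a) * (x b - m b) * g x) (x₀ : κ → ℝ) :
    g x₀ ^ 2 ≤ (128 * C ^ 2) ^ Fintype.card κ := by
  rcases (hg.1 x₀).eq_or_lt with h0 | hx₀
  · rw [← h0, zero_pow two_ne_zero]
    positivity
  have hgi : Integrable g := by
    by_contra h
    rw [integral_undef h] at h1
    exact zero_ne_one h1
  have hsi := integrable_sqrt_of_isBounded hg.1 hB hgB hgi
  have hI := integral_sqrt_pos hg.1 hsi h1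
  obtain ⟨M, hM⟩ : ∃ M, IsLUB (Set.range g) M := by
    refine ⟨_, isLUB_csSup (Set.range_nonempty g)
      ⟨(2 ^ Module.finrank ℝ (κ → ℝ) / ∫ x, √(g x)) ^ 2, ?_⟩⟩
    rintro _ ⟨x, rfl⟩
    have := hg.sqrt_mul_integral_le volume hgi hsi x
    rw [h1, mul_one, ← le_div_iff₀ hI] at this
    rw [← Real.sq_sqrt (hg.1 x)]
    gcongr
  have hM0 : 0 < M := hx₀.trans_le (hM.1 ⟨x₀, rfl⟩)
  obtain ⟨_, ⟨p, rfl⟩, hp⟩ := (lt_isLUB_iff hM).1 (show 7 / 8 * M < M by linarith)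
  obtain ⟨z, ρ, hρ, hz⟩ := hg.exists_closedBall_le volume h1 (by positivity) hp
  obtain ⟨A, hA, hdev⟩ := exists_lintegral_empirical_deviation_le hg.1 hB hgB h1 hm
    (G := fun a b => ∫ x, (x a - m a) * (x b - m b) * g x) fun a b => rfl
  have hn0 : 0 < (Fintype.card κ : ℝ) := by exact_mod_cast Fintype.card_pos
  set n := Fintype.card κ
  refine le_of_eventually_pow_le_mul_pow (A := 16 * (n ^ 2 / ρ ^ 2) ^ n) (k := 3 * n)
    (by positivity) ?_
  obtain ⟨N₀, hN₀⟩ := exists_nat_ge (640 * (A + 1))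
  filter_upwards [Filter.eventually_ge_atTop 2, Filter.eventually_ge_atTop N₀] with N hN2 hN
  have hN' : 640 * (A + 1) ≤ N := hN₀.trans (by exact_mod_cast hN)
  have hNpos : (0 : ℝ) < N := by positivity
  have key := hC.pow_le_of_density hg hB hgB h1 hcov hN2 (τ := (A + 1) / N) (by positivity)
    (by rw [mul_div_assoc', div_le_div_iff₀ hNpos (by norm_num)]; linarith)
    ((hdev N (by omega)).trans (ENNReal.ofReal_le_ofReal (by gcongr; linarith))) hM hz hx₀
  have e1 : (1 / 8 : ℝ) ^ (N - 1) * (ρ ^ 2 / (8 * n ^ 2 * N ^ 3)) =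
      ρ ^ 2 / n ^ 2 / (8 ^ N * N ^ 3) := by
    obtain ⟨k, rfl⟩ : ∃ k, N = k + 1 := ⟨N - 1, by omega⟩
    rw [Nat.add_sub_cancel, pow_succ (8 : ℝ) k, one_div, inv_pow]
    field_simp
  rw [e1, div_pow (4 ^ _ * _), mul_div_assoc', le_div_iff₀ (by positivity), div_pow,
    div_mul_eq_mul_div,
    div_le_iff₀ (by positivity)] at key
  have hr : 0 < (ρ ^ 2 / (n : ℝ) ^ 2) ^ n := by positivity
  rw [← le_div_iff₀' hr] at key
  calc (g x₀ ^ 2) ^ N = (g x₀ ^ N) ^ 2 := by rw [← pow_mul, ← pow_mul, mul_comm]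
    _ ≤ _ := key
    _ = _ := by
      have e2 : (128 * C ^ 2 : ℝ) = 8 * (4 ^ 2) * C ^ 2 := by norm_num
      rw [e2, div_eq_mul_inv, ← inv_pow, inv_div]
      simp only [mul_pow, ← pow_mul]
      ring

lemma mul_sum_sq_le_of_abs_sub_le {κ : Type*} [Fintype κ] [DecidableEq κ] [Nonempty κ]
    {G : κ → κ → ℝ} {η : ℝ} (hG : ∀ a b, |G a b - if a = b then 1 else 0| ≤ η / Fintype.card κ)
    (θ : κ → ℝ) : (1 - η) * ∑ a, θ a ^ 2 ≤ ∑ a, ∑ b, θ a * θ b * G a b := by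
  have hn : (0 : ℝ) < Fintype.card κ := by exact_mod_cast Fintype.card_pos
  have hterm : ∀ a b, (if a = b then θ a * θ b else 0) -
      η / Fintype.card κ * ((θ a ^ 2 + θ b ^ 2) / 2) ≤ θ a * θ b * G a b := fun a b => by
    have e : θ a * θ b * G a b = (if a = b then θ a * θ b else 0) +
        θ a * θ b * (G a b - if a = b then 1 else 0) := by
      split_ifs <;> ring
    have h1 := neg_abs_le (θ a * θ b * (G a b - if a = b then 1 else 0))
    rw [abs_mul] at h1
    have h2 : |θ a * θ b| ≤ (θ a ^ 2 + θ b ^ 2) / 2 := by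
      rw [abs_mul]
      nlinarith [sq_nonneg (|θ a| - |θ b|), sq_abs (θ a), sq_abs (θ b)]
    have h3 := mul_le_mul h2 (hG a b) (abs_nonneg _) (by positivity)
    rw [e]
    linarith
  refine le_trans (le_of_eq ?_)
    (Finset.sum_le_sum fun a _ => Finset.sum_le_sum fun b _ => hterm a b)
  simp only [Finset.sum_sub_distrib, Finset.sum_ite_eq, Finset.mem_univ, if_true,
    ← Finset.mul_sum, ← Finset.sum_div, Finset.sum_add_distrib, Finset.sum_const, Finset.card_univ,
    nsmul_eq_mul]
  field_simp
  ring

lemma BodyConstantLE.sq_le_of_isotropic {C : ℝ} (hC : BodyConstantLE C) {κ : Type*} [Fintype κ]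
    [DecidableEq κ] [Nonempty κ] {f : (κ → ℝ) → ℝ} (hf : IsLogConcaveFun f) (h1 : ∫ x, f x = 1)
    (hmean : ∀ a, ∫ x, x a * f x = 0)
    (hcov : ∀ a b, ∫ x, x a * x b * f x = if a = b then 1 else 0) (x₀ : κ → ℝ) :
    f x₀ ^ 2 ≤ (128 * C ^ 2) ^ Fintype.card κ := by
  have hfi : Integrable f := by
    by_contra h
    rw [integral_undef h] at h1
    exact zero_ne_one h1
  have hcovi : ∀ a b, Integrable fun x => x a * x b * f x := by
    have hdiag : ∀ a, Integrable fun x => x a * x a * f x := fun a => by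
      by_contra h
      have := hcov a a
      rw [integral_undef h, if_pos rfl] at this
      exact zero_ne_one this
    refine fun a b => ((hdiag a).add (hdiag b)).mono' (AEStronglyMeasurable.mul
      (by fun_prop : Continuous fun x : κ → ℝ => x a * x b).aestronglyMeasurable hfi.1)
      (ae_of_all _ fun x => ?_)
    rw [norm_mul, Real.norm_of_nonneg (hf.1 x), Pi.add_apply, ← add_mul]
    refine mul_le_mul_of_nonneg_right ?_ (hf.1 x)
    rw [Real.norm_eq_abs, abs_le]
    constructor <;> nlinarith [sq_nonneg (x a + x b), sq_nonneg (x a - x b)]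
  have hmi : ∀ a, Integrable fun x => x a * f x := fun a => by
    refine (hfi.add (hcovi a a)).mono'
      ((continuous_apply a).aestronglyMeasurable.mul hfi.1) (ae_of_all _ fun x => ?_)
    rw [norm_mul, Real.norm_eq_abs, Real.norm_of_nonneg (hf.1 x), Pi.add_apply]
    have : |x a| ≤ 1 + x a * x a := by
      nlinarith [sq_abs (x a), sq_nonneg (|x a| - 1), abs_nonneg (x a)]
    nlinarith [hf.1 x]
  set B : ℕ → Set (κ → ℝ) := fun k => Metric.closedBall 0 k with hB
  set Z : ℕ → ℝ := fun k => ∫ x in B k, f x with hZ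
  have hcover : AECover volume Filter.atTop B :=
    aecover_closedBall tendsto_natCast_atTop_atTop
  have hZlim : Filter.Tendsto Z Filter.atTop (nhds 1) := by
    rw [← h1]
    exact hcover.integral_tendsto_of_countably_generated hfi
  set g : ℕ → (κ → ℝ) → ℝ := fun k x => (Z k)⁻¹ * (B k).indicator f x with hg
  have hBm : ∀ k, MeasurableSet (B k) := fun k => Metric.isClosed_closedBall.measurableSet
  have hform : ∀ k (h : (κ → ℝ) → ℝ), (fun x => h x * g k x) =
      fun x => (Z k)⁻¹ * (B k).indicator (fun x => h x * f x) x := fun k h => by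
    ext x
    by_cases hx : x ∈ B k
    · simp only [hg, Set.indicator_of_mem hx]; ring
    · simp only [hg, Set.indicator_of_notMem hx]; ring
  have hgint : ∀ k (h : (κ → ℝ) → ℝ), Integrable (fun x => h x * f x) →
      Integrable fun x => h x * g k x := fun k h hi => by
    rw [hform]
    exact (hi.indicator (hBm k)).const_mul _
  have hglim : ∀ h : (κ → ℝ) → ℝ, Integrable (fun x => h x * f x) →
      Filter.Tendsto (fun k => ∫ x, h x * g k x) Filter.atTop (nhds (∫ x, h x * f x)) := by
    intro h hi
    have := (hZlim.inv₀ one_ne_zero).mul (hcover.integral_tendsto_of_countably_generated hi)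
    rw [inv_one, one_mul] at this
    refine this.congr fun k => ?_
    rw [hform, integral_const_mul, integral_indicator (hBm k)]
  have hg1 : ∀ k, 0 < Z k → ∫ x, g k x = 1 := fun k hk => by
    simp only [hg]
    rw [integral_const_mul, integral_indicator (hBm k)]
    exact inv_mul_cancel₀ hk.ne'
  set m : ℕ → κ → ℝ := fun k a => ∫ x, x a * g k x with hm
  have hmlim : ∀ a, Filter.Tendsto (fun k => m k a) Filter.atTop (nhds 0) := fun a => by
    rw [← hmean a]
    exact hglim (fun x => x a) (hmi a)
  have hclim : ∀ a b, Filter.Tendsto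
      (fun k => (∫ x, x a * x b * g k x) - m k a * m k b) Filter.atTop
      (nhds (if a = b then 1 else 0)) := fun a b => by
    have := (hglim (fun x => x a * x b) (hcovi a b)).sub ((hmlim a).mul (hmlim b))
    rwa [hcov, mul_zero, sub_zero] at this
  have hn : (0 : ℝ) < Fintype.card κ := by exact_mod_cast Fintype.card_pos
  have hev : ∀ᶠ k in Filter.atTop, ∀ a b, |(∫ x, x a * x b * g k x) - m k a * m k b -
      if a = b then 1 else 0| ≤ 3 / 4 / Fintype.card κ := by
    refine Filter.eventually_all.2 fun a => Filter.eventually_all.2 fun b => ?_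
    filter_upwards [Metric.tendsto_nhds.1 (hclim a b) (3 / 4 / Fintype.card κ) (by positivity)]
      with k hk
    exact hk.le
  obtain ⟨k, hk, hkZ, hkx⟩ := (hev.and ((hZlim.eventually_const_lt zero_lt_one).and
    (tendsto_natCast_atTop_atTop.eventually_ge_atTop ‖x₀‖))).exists
  have hgi : Integrable (g k) := by simpa using hgint k (fun _ => 1) (by simpa using hfi)
  have hgm := fun a => hgint k (fun x => x a) (hmi a)
  have hgc := fun a b => hgint k (fun x => x a * x b) (hcovi a b)
  have hZ1 : Z k ≤ 1 := by
    rw [← h1]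
    exact setIntegral_le_integral hfi (ae_of_all _ hf.1)
  have hx₀ : f x₀ ≤ g k x₀ := by
    have : x₀ ∈ B k := by simpa [hB] using hkx
    simp only [hg, Set.indicator_of_mem this]
    exact le_mul_of_one_le_left (hf.1 _) ((one_le_inv₀ hkZ).2 hZ1)
  refine (pow_le_pow_left₀ (hf.1 _) hx₀ 2).trans (hC.sq_le_of_isBounded (g := g k) (m := m k)
    ((hf.indicator (convex_closedBall 0 (k : ℝ))).const_mul (inv_pos.2 hkZ))
    (Metric.isBounded_closedBall (x := 0) (r := (k : ℝ)))
    (fun x hx => by simp [hg, hB, Set.indicator_of_notMem hx]) (hg1 k hkZ) ?_ ?_ x₀)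
  · intro a
    simp_rw [sub_mul]
    rw [integral_sub (hgm a) (hgi.const_mul _), integral_const_mul, hg1 k hkZ, mul_one, sub_self]
  · intro θ
    have hG : ∀ a b, ∫ x, (x a - m k a) * (x b - m k b) * g k x =
        (∫ x, x a * x b * g k x) - m k a * m k b := fun a b => by
      have : ∀ x : κ → ℝ, (x a - m k a) * (x b - m k b) * g k x = x a * x b * g k x -
          m k a * (x b * g k x) - m k b * (x a * g k x) + m k a * m k b * g k x := fun x => by ring
      simp_rw [this]
      have i1 : Integrable fun x => x a * x b * g k x - m k a * (x b * g k x) :=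
        (hgc a b).sub ((hgm b).const_mul _)
      have i2 : Integrable fun x =>
          x a * x b * g k x - m k a * (x b * g k x) - m k b * (x a * g k x) :=
        i1.sub ((hgm a).const_mul _)
      rw [integral_add i2 (hgi.const_mul _), integral_sub i1 ((hgm a).const_mul _),
        integral_sub (hgc a b) ((hgm b).const_mul _), integral_const_mul, integral_const_mul,
        integral_const_mul, hg1 k hkZ]
      simp only [hm]
      ring
    simp_rw [hG]
    have := mul_sum_sq_le_of_abs_sub_le hk θ
    norm_num at this ⊢
    exact this

lemma integral_withDensity_ofReal {X : Type*} [MeasurableSpace X] {μ : Measure X} {f : X → ℝ}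
    (hf : AEMeasurable f μ) (f0 : ∀ x, 0 ≤ f x) (h : X → ℝ) :
    ∫ x, h x ∂μ.withDensity (fun x => ENNReal.ofReal (f x)) = ∫ x, h x * f x ∂μ := by
  rw [integral_withDensity_eq_integral_toReal_smul₀ hf.ennreal_ofReal
    (ae_of_all _ fun _ => ENNReal.ofReal_lt_top)]
  exact integral_congr_ae (ae_of_all _ fun x => by
    simp only [ENNReal.toReal_ofReal (f0 x), smul_eq_mul, mul_comm])

lemma BodyConstantLE.sq_le_of_isIsotropicMeasure {C : ℝ} (hC : BodyConstantLE C) {n : ℕ}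
    (hn : 1 ≤ n) {f : EuclideanSpace ℝ (Fin n) → ℝ} (hf : IsLogConcaveFun f)
    (hp : IsProbabilityMeasure (volume.withDensity fun x => ENNReal.ofReal (f x)))
    (hi : IsIsotropicMeasure (volume.withDensity fun x => ENNReal.ofReal (f x)))
    (x : EuclideanSpace ℝ (Fin n)) : f x ^ 2 ≤ (128 * C ^ 2) ^ n := by
  have : Nonempty (Fin n) := ⟨⟨0, hn⟩⟩
  have hfm := hf.aemeasurable volume
  have hmp := PiLp.volume_preserving_toLp (Fin n)
  have hme : MeasurableEmbedding (WithLp.toLp 2 : (Fin n → ℝ) → EuclideanSpace ℝ (Fin n)) :=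
    (MeasurableEquiv.toLp 2 (Fin n → ℝ)).measurableEmbedding
  have hint : ∀ h : EuclideanSpace ℝ (Fin n) → ℝ, ∫ y : Fin n → ℝ, h (WithLp.toLp 2 y) *
      f (WithLp.toLp 2 y) = ∫ x, h x ∂volume.withDensity fun x => ENNReal.ofReal (f x) :=
      fun h => by
    rw [integral_withDensity_ofReal hfm hf.1, ← hmp.integral_comp hme]
  have hf' : IsLogConcaveFun fun y : Fin n → ℝ => f (WithLp.toLp 2 y) :=
    hf.comp_linearMap (WithLp.linearEquiv 2 ℝ (Fin n → ℝ)).symm.toLinearMap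
  have := hC.sq_le_of_isotropic hf' (by simpa using hint fun _ => 1)
    (fun a => (hint fun x => x a).trans (hi.1 a))
    (fun a b => (hint fun x => x a * x b).trans (hi.2 a b)) (WithLp.ofLp x)
  simpa using this

lemma IsConvexIsotropic.exists_density {n : ℕ} {K : Set (EuclideanSpace ℝ (Fin n))} {L : ℝ}
    (hK : IsConvexIsotropic K L) :
    ∃ f : EuclideanSpace ℝ (Fin n) → ℝ, IsLogConcaveFun f ∧
      IsProbabilityMeasure (volume.withDensity fun x => ENNReal.ofReal (f x)) ∧
      IsIsotropicMeasure (volume.withDensity fun x => ENNReal.ofReal (f x)) ∧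
      ∃ x, f x = L ^ n := by
  obtain ⟨⟨hKc, hKconv, hKint⟩, hvol, hL, hmean, hcov⟩ := hK
  set f : EuclideanSpace ℝ (Fin n) → ℝ := fun x => L ^ n * K.indicator (fun _ => 1) (L • x) with hf
  have hone : IsLogConcaveFun fun _ : EuclideanSpace ℝ (Fin n) => (1 : ℝ) :=
    ⟨fun _ => zero_le_one, fun _ _ _ _ _ => by simp⟩
  have hfc : IsLogConcaveFun f :=
    ((hone.indicator hKconv).comp_linearMap (L • LinearMap.id)).const_mul (pow_pos hL n)
  have hint : ∀ h : EuclideanSpace ℝ (Fin n) → ℝ,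
      ∫ x, h x * f x = ∫ y in K, h (L⁻¹ • y) := fun h => by
    have e : (fun x => h x * f x) =
        fun x => L ^ n * K.indicator (fun y => h (L⁻¹ • y)) (L • x) := by
      ext x
      by_cases hx : L • x ∈ K
      · simp only [hf, Set.indicator_of_mem hx, inv_smul_smul₀ hL.ne']; ring
      · simp only [hf, Set.indicator_of_notMem hx]; ring
    rw [e, integral_const_mul, Measure.integral_comp_smul volume
      (K.indicator fun y => h (L⁻¹ • y)) L, integral_indicator hKc.measurableSet,
      finrank_euclideanSpace_fin, abs_of_pos (by positivity), smul_eq_mul,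
      mul_inv_cancel_left₀ (by positivity)]
  have h1 : ∫ x, f x = 1 := by
    have := hint fun _ => 1
    simpa [measureReal_def, hvol] using this
  have hfi : Integrable f := by
    by_contra h
    rw [integral_undef h] at h1
    exact zero_ne_one h1
  refine ⟨f, hfc, ⟨?_⟩, ⟨fun i => ?_, fun i j => ?_⟩, ?_⟩
  · rw [withDensity_apply _ MeasurableSet.univ, setLIntegral_univ,
      ← ofReal_integral_eq_lintegral_ofReal hfi (ae_of_all _ hfc.1), h1, ENNReal.ofReal_one]
  · rw [integral_withDensity_ofReal hfi.1.aemeasurable hfc.1, hint]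
    simp only [PiLp.smul_apply, smul_eq_mul]
    rw [integral_const_mul, hmean, mul_zero]
  · rw [integral_withDensity_ofReal hfi.1.aemeasurable hfc.1, hint]
    simp only [PiLp.smul_apply, smul_eq_mul, mul_mul_mul_comm]
    rw [integral_const_mul, hcov]
    split_ifs
    · field_simp
    · rw [mul_zero]
  · obtain ⟨k, hk⟩ := hKint
    refine ⟨L⁻¹ • k, ?_⟩
    simp only [hf, smul_inv_smul₀ hL.ne', Set.indicator_of_mem (interior_subset hk), mul_one]

/-- `sup_{n ≥ 1} Lₙ < +∞` if and only if `sup_{n ≥ 1} L̃ₙ < +∞`: the isotropic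
constants of convex bodies in convex isotropic position are uniformly bounded if and
only if `L_f = sup_x f(x)^{1/n}` is uniformly bounded over all isotropic log-concave
probability densities `f` on `ℝⁿ`, `n ≥ 1`. -/
theorem bounded_body_constant_iff_bounded_density_constant :
    (∃ C : ℝ, ∀ n : ℕ, 1 ≤ n → ∀ (K : Set (EuclideanSpace ℝ (Fin n))) (L : ℝ),
        IsConvexIsotropic K L → L ≤ C) ↔
    (∃ C : ℝ, ∀ n : ℕ, 1 ≤ n → ∀ f : EuclideanSpace ℝ (Fin n) → ℝ,
        IsLogConcaveFun f →
        IsProbabilityMeasure (volume.withDensity fun x => ENNReal.ofReal (f x)) →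
        IsIsotropicMeasure (volume.withDensity fun x => ENNReal.ofReal (f x)) →
        ∀ x, f x ^ (1 / (n : ℝ)) ≤ C) := by
  constructor
  · rintro ⟨C, hC⟩
    refine ⟨√(128 * C ^ 2), fun n hn f hf hp hi x => ?_⟩
    have h := BodyConstantLE.sq_le_of_isIsotropicMeasure hC hn hf hp hi x
    have h0 : (0 : ℝ) ≤ 128 * C ^ 2 := by positivity
    have h2 : f x ≤ √(128 * C ^ 2) ^ n := by
      refine (sq_le_sq₀ (hf.1 x) (by positivity)).1 ?_
      rwa [← pow_mul, mul_comm n, pow_mul, Real.sq_sqrt h0]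
    rw [one_div, ← Real.pow_rpow_inv_natCast (Real.sqrt_nonneg (128 * C ^ 2)) (by omega : n ≠ 0)]
    exact Real.rpow_le_rpow (hf.1 x) h2 (by positivity)
  · rintro ⟨C, hC⟩
    refine ⟨C, fun n hn K L hK => ?_⟩
    obtain ⟨f, hf, hp, hi, x, hx⟩ := hK.exists_density
    have := hC n hn f hf hp hi x
    rwa [hx, one_div, Real.pow_rpow_inv_natCast hK.2.2.1.le (by omega : n ≠ 0)] at this

end
end
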